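/- Let T be a locally finite leafless ℝ-tree with at least three ends, and let G be a group of isometries of T whose induced action on ∂∞T is two-transitive (transitive on ordered pairs of distinct ends). Assume moreover that ∂∞T is infinite. Then an isometry h ∈ G is elliptic if and only if one of the following two conditions holds: (i) the number of ends of T fixed by h is different from 2; (ii) h fixes exactly two ends a and b of ∂∞T, and there exist an isometry g ∈ G fixing no end of T with g({a, b}) ≠ {a, b}, and a positive integer N, such that for every n ∈ ℤ \ {0} the isometry g∘h^{N·n} fixes no end of T. -/

import Mathlib

/-- `s` is a geodesic segment joining `x` to `y`: the image of an isometric embedding of a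
compact real interval, with endpoints `x` and `y`. -/
def IsGeodesicSegmentBetween {X : Type*} [MetricSpace X] (s : Set X) (x y : X) : Prop :=
  ∃ (γ : ℝ → X) (b : ℝ), 0 ≤ b ∧
    (∀ u ∈ Set.Icc (0 : ℝ) b, ∀ v ∈ Set.Icc (0 : ℝ) b, dist (γ u) (γ v) = |u - v|) ∧
    γ 0 = x ∧ γ b = y ∧ s = γ '' Set.Icc 0 b

/-- `s` is a geodesic segment. -/
def IsGeodesicSegment {X : Type*} [MetricSpace X] (s : Set X) : Prop :=
  ∃ x y : X, IsGeodesicSegmentBetween s x y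

/-- An ℝ-tree: any two points are joined by a unique geodesic segment, and if two geodesic
segments meet exactly in a common endpoint then their union is a geodesic segment. -/
def IsRTree (X : Type*) [MetricSpace X] : Prop :=
  (∀ x y : X, ∃! s : Set X, IsGeodesicSegmentBetween s x y) ∧
  (∀ (s t : Set X) (x y z : X), IsGeodesicSegmentBetween s x y →
    IsGeodesicSegmentBetween t y z → s ∩ t = {y} → IsGeodesicSegmentBetween (s ∪ t) x z)

/-- `X` is leafless: every geodesic segment is contained in a strictly larger geodesic segment
extending it beyond each endpoint. -/
def Leafless (X : Type*) [MetricSpace X] : Prop :=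
  ∀ (x y : X) (s : Set X), IsGeodesicSegmentBetween s x y →
    ∃ (x' y' : X) (s' : Set X), IsGeodesicSegmentBetween s' x' y' ∧ s ⊆ s' ∧
      0 < dist x' x ∧ 0 < dist y y' ∧ dist x' y' = dist x' x + dist x y + dist y y'

/-- A ray: the image of an isometric embedding of `[0, ∞)`. -/
def IsRay {X : Type*} [MetricSpace X] (R : Set X) : Prop :=
  ∃ γ : ℝ → X, (∀ u ∈ Set.Ici (0 : ℝ), ∀ v ∈ Set.Ici (0 : ℝ), dist (γ u) (γ v) = |u - v|) ∧
    R = γ '' Set.Ici 0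

/-- A ray starting at the point `x`. -/
def IsRayFrom {X : Type*} [MetricSpace X] (x : X) (R : Set X) : Prop :=
  ∃ γ : ℝ → X, (∀ u ∈ Set.Ici (0 : ℝ), ∀ v ∈ Set.Ici (0 : ℝ), dist (γ u) (γ v) = |u - v|) ∧
    γ 0 = x ∧ R = γ '' Set.Ici 0

/-- An end of `X`, regarded as the set of all rays equivalent to a given ray (two rays are
equivalent when their intersection is a ray). -/
def IsEnd {X : Type*} [MetricSpace X] (e : Set (Set X)) : Prop :=
  ∃ R : Set X, IsRay R ∧ e = {R' : Set X | IsRay R' ∧ IsRay (R' ∩ R)}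

/-- The action of a map on ends (as sets of rays), by pushing every ray forward. -/
def pushEnd {X Y : Type*} (φ : X → Y) (e : Set (Set X)) : Set (Set Y) :=
  (Set.image φ) '' e

/-- Two rays starting at `x` locally coincide: their intersection contains more than `x`. -/
def LocCoincide {X : Type*} [MetricSpace X] (x : X) (R R' : Set X) : Prop :=
  ∃ p, p ∈ R ∩ R' ∧ p ≠ x

/-- `x` is a branch point: the valency of `x` (number of directions at `x`, i.e. classes of
rays from `x` up to local coincidence) is at least `3`. -/
def IsBranchPoint {X : Type*} [MetricSpace X] (x : X) : Prop :=
  ∃ R₁ R₂ R₃ : Set X, IsRayFrom x R₁ ∧ IsRayFrom x R₂ ∧ IsRayFrom x R₃ ∧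
    ¬ LocCoincide x R₁ R₂ ∧ ¬ LocCoincide x R₁ R₃ ∧ ¬ LocCoincide x R₂ R₃

/-- `X` is locally finite: every point has finite valency, i.e. finitely many directions. -/
def LocallyFiniteTree (X : Type*) [MetricSpace X] : Prop :=
  ∀ x : X, ∃ (n : ℕ) (Rs : Fin n → Set X), (∀ i, IsRayFrom x (Rs i)) ∧
    ∀ R : Set X, IsRayFrom x R → ∃ i, LocCoincide x R (Rs i)

/-- `X` admits at least three ends. -/
def AtLeastThreeEnds (X : Type*) [MetricSpace X] : Prop :=
  ∃ e₁ e₂ e₃ : Set (Set X), IsEnd e₁ ∧ IsEnd e₂ ∧ IsEnd e₃ ∧ e₁ ≠ e₂ ∧ e₁ ≠ e₃ ∧ e₂ ≠ e₃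

/-- `fbar : X → Y` induces the map `f` on ends: every ray lying in an end `e` is sent to a
ray lying in the end `f e`. -/
def Induces {X Y : Type*} [MetricSpace X] [MetricSpace Y]
    (fbar : X → Y) (f : Set (Set X) → Set (Set Y)) : Prop :=
  ∀ e : Set (Set X), IsEnd e → ∀ R ∈ e, fbar '' R ∈ f e

open Filter

/-- A geodesic metric space satisfying Gromov's four point condition. -/
structure IsGeodesicZeroHyperbolic (X : Type*) [MetricSpace X] : Prop where
  exists_between : ∀ (x y : X) (t : ℝ), 0 ≤ t → t ≤ dist x y →
    ∃ p, dist x p = t ∧ dist p y = dist x y - t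
  four_point : ∀ x y z w : X,
    dist x y + dist z w ≤ max (dist x z + dist y w) (dist x w + dist y z)

section RTree

variable {X : Type*} [MetricSpace X]

theorem IsGeodesicSegmentBetween.dist_add_dist {s : Set X} {x y p : X}
    (hs : IsGeodesicSegmentBetween s x y) (hp : p ∈ s) : dist x p + dist p y = dist x y := by
  obtain ⟨γ, b, hb, hγ, rfl, rfl, rfl⟩ := hs
  obtain ⟨t, ht, rfl⟩ := hp
  have h0 : (0 : ℝ) ∈ Set.Icc 0 b := ⟨le_rfl, hb⟩
  have h1 : b ∈ Set.Icc 0 b := ⟨hb, le_rfl⟩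
  rw [hγ 0 h0 t ht, hγ t ht b h1, hγ 0 h0 b h1, abs_of_nonpos (by linarith [ht.1]),
    abs_of_nonpos (by linarith [ht.2]), abs_of_nonpos (by linarith)]
  ring

theorem IsGeodesicSegmentBetween.eq_of_dist_eq {s : Set X} {x y p q : X}
    (hs : IsGeodesicSegmentBetween s x y) (hp : p ∈ s) (hq : q ∈ s) (h : dist x p = dist x q) :
    p = q := by
  obtain ⟨γ, b, hb, hγ, rfl, rfl, rfl⟩ := hs
  obtain ⟨t, ht, rfl⟩ := hp
  obtain ⟨u, hu, rfl⟩ := hq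
  have h0 : (0 : ℝ) ∈ Set.Icc 0 b := ⟨le_rfl, hb⟩
  rw [hγ 0 h0 t ht, hγ 0 h0 u hu, abs_of_nonpos (by linarith [ht.1]),
    abs_of_nonpos (by linarith [hu.1])] at h
  rw [show t = u by linarith]

theorem IsRTree.exists_geodesic (hX : IsRTree X) (x y : X) : ∃ γ : ℝ → X,
    (∀ u ∈ Set.Icc (0 : ℝ) (dist x y), ∀ v ∈ Set.Icc (0 : ℝ) (dist x y),
      dist (γ u) (γ v) = |u - v|) ∧ γ 0 = x ∧ γ (dist x y) = y := by
  obtain ⟨s, ⟨γ, b, hb, hγ, rfl, rfl, -⟩, -⟩ := hX.1 x y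
  have : dist (γ 0) (γ b) = b := by
    rw [hγ 0 ⟨le_rfl, hb⟩ b ⟨hb, le_rfl⟩, zero_sub, abs_neg, abs_of_nonneg hb]
  exact ⟨γ, by rwa [this], rfl, by rw [this]⟩

theorem IsRTree.exists_segment_mem (hX : IsRTree X) {x y p : X}
    (h : dist x p + dist p y = dist x y) : ∃ s, IsGeodesicSegmentBetween s x y ∧ p ∈ s := by
  obtain ⟨γ, hγ, hγ0, hγ1⟩ := hX.exists_geodesic x p
  obtain ⟨δ, hδ, hδ0, hδ1⟩ := hX.exists_geodesic p y
  have hxp := dist_nonneg (x := x) (y := p)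
  have hpy := dist_nonneg (x := p) (y := y)
  have key : ∀ u ∈ Set.Icc 0 (dist x p), ∀ v ∈ Set.Icc 0 (dist p y),
      dist (γ u) (δ v) = dist x p - u + v := by
    intro u hu v hv
    have e1 : dist x (γ u) = u := by
      conv_lhs => rw [← hγ0]
      rw [hγ 0 ⟨le_rfl, hxp⟩ u hu, zero_sub, abs_neg, abs_of_nonneg hu.1]
    have e2 : dist (γ u) p = dist x p - u := by
      conv_lhs => rw [← hγ1]
      rw [hγ u hu _ ⟨hxp, le_rfl⟩, abs_of_nonpos (by linarith [hu.2])]; ring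
    have e3 : dist p (δ v) = v := by
      conv_lhs => rw [← hδ0]
      rw [hδ 0 ⟨le_rfl, hpy⟩ v hv, zero_sub, abs_neg, abs_of_nonneg hv.1]
    have e4 : dist (δ v) y = dist p y - v := by
      conv_lhs => rw [← hδ1]
      rw [hδ v hv _ ⟨hpy, le_rfl⟩, abs_of_nonpos (by linarith [hv.2])]; ring
    have t1 := dist_triangle (γ u) p (δ v)
    have t2 := dist_triangle4 x (γ u) (δ v) y
    linarith
  refine ⟨_, ⟨fun u => if u ≤ dist x p then γ u else δ (u - dist x p), dist x y, dist_nonneg,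
    ?_, ?_, ?_, rfl⟩, dist x p, ⟨hxp, by linarith⟩, by simp [hγ1]⟩
  · intro u hu v hv
    dsimp only
    split_ifs with h1 h2 h2
    · exact hγ u ⟨hu.1, h1⟩ v ⟨hv.1, h2⟩
    · rw [key u ⟨hu.1, h1⟩ _ ⟨by linarith, by linarith [hv.2]⟩, abs_of_nonpos (by linarith)]
      ring
    · rw [dist_comm, key v ⟨hv.1, h2⟩ _ ⟨by linarith, by linarith [hu.2]⟩,
        abs_of_nonneg (by linarith)]
      ring
    · rw [hδ _ ⟨by linarith, by linarith [hu.2]⟩ _ ⟨by linarith, by linarith [hv.2]⟩]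
      congr 1
      ring
  · simp [hγ0]
  · dsimp only
    split_ifs with h1
    · have : dist p y = 0 := by linarith
      rw [← h, this, add_zero, hγ1]
      exact dist_eq_zero.1 this
    · rw [← h, add_sub_cancel_left, hδ1]

theorem IsRTree.eq_of_dist_eq (hX : IsRTree X) {x y p q : X}
    (hp : dist x p + dist p y = dist x y) (hq : dist x q + dist q y = dist x y)
    (h : dist x p = dist x q) : p = q := by
  obtain ⟨s, hs, hps⟩ := hX.exists_segment_mem hp
  obtain ⟨t, ht, hqt⟩ := hX.exists_segment_mem hq
  obtain rfl := (hX.1 x y).unique hs ht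
  exact hs.eq_of_dist_eq hps hqt h

theorem IsRTree.exists_between (hX : IsRTree X) (x y : X) (t : ℝ) (h0 : 0 ≤ t)
    (h1 : t ≤ dist x y) : ∃ p, dist x p = t ∧ dist p y = dist x y - t := by
  obtain ⟨γ, hγ, hγ0, hγ1⟩ := hX.exists_geodesic x y
  refine ⟨γ t, ?_, ?_⟩
  · conv_lhs => rw [← hγ0]
    rw [hγ 0 ⟨le_rfl, dist_nonneg⟩ t ⟨h0, h1⟩, zero_sub, abs_neg, abs_of_nonneg h0]
  · conv_lhs => rw [← hγ1]
    rw [hγ t ⟨h0, h1⟩ _ ⟨dist_nonneg, le_rfl⟩, abs_of_nonpos (by linarith)]; ring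

theorem IsRTree.exists_median (hX : IsRTree X) (x y z : X) : ∃ m,
    dist x m + dist m y = dist x y ∧ dist x m + dist m z = dist x z ∧
      dist y m + dist m z = dist y z := by
  obtain ⟨γ, hγ, hγ0, hγ1⟩ := hX.exists_geodesic x y
  obtain ⟨δ, hδ, hδ0, hδ1⟩ := hX.exists_geodesic x z
  have hxy := dist_nonneg (x := x) (y := y)
  have hxz := dist_nonneg (x := x) (y := z)
  have γx : ∀ u ∈ Set.Icc 0 (dist x y), dist x (γ u) = u := by
    intro u hu
    conv_lhs => rw [← hγ0]
    rw [hγ 0 ⟨le_rfl, hxy⟩ u hu, zero_sub, abs_neg, abs_of_nonneg hu.1]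
  have γy : ∀ u ∈ Set.Icc 0 (dist x y), dist (γ u) y = dist x y - u := by
    intro u hu
    conv_lhs => rw [← hγ1]
    rw [hγ u hu _ ⟨hxy, le_rfl⟩, abs_of_nonpos (by linarith [hu.2])]; ring
  have δx : ∀ u ∈ Set.Icc 0 (dist x z), dist x (δ u) = u := by
    intro u hu
    conv_lhs => rw [← hδ0]
    rw [hδ 0 ⟨le_rfl, hxz⟩ u hu, zero_sub, abs_neg, abs_of_nonneg hu.1]
  have δz : ∀ u ∈ Set.Icc 0 (dist x z), dist (δ u) z = dist x z - u := by
    intro u hu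
    conv_lhs => rw [← hδ1]
    rw [hδ u hu _ ⟨hxz, le_rfl⟩, abs_of_nonpos (by linarith [hu.2])]; ring
  set S : Set ℝ := {t | 0 ≤ t ∧ t ≤ dist x y ∧ t ≤ dist x z ∧ γ t = δ t} with hS
  have hS0 : (0 : ℝ) ∈ S := ⟨le_rfl, hxy, hxz, by rw [hγ0, hδ0]⟩
  have hSb : BddAbove S := ⟨dist x y, fun t ht => ht.2.1⟩
  set r := sSup S with hr
  have hr0 : 0 ≤ r := le_csSup hSb hS0
  have hry : r ≤ dist x y := csSup_le ⟨0, hS0⟩ fun t ht => ht.2.1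
  have hrz : r ≤ dist x z := csSup_le ⟨0, hS0⟩ fun t ht => ht.2.2.1
  have hrS : γ r = δ r := by
    refine dist_le_zero.1 (le_of_forall_pos_le_add fun ε hε => ?_)
    obtain ⟨t, ht, hlt⟩ := exists_lt_of_lt_csSup ⟨0, hS0⟩ (show r - ε / 2 < sSup S by linarith)
    have htr : t ≤ r := le_csSup hSb ht
    have e1 := hγ r ⟨hr0, hry⟩ t ⟨ht.1, ht.2.1⟩
    have e2 := hδ t ⟨ht.1, ht.2.2.1⟩ r ⟨hr0, hrz⟩
    rw [abs_of_nonneg (by linarith)] at e1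
    rw [abs_of_nonpos (by linarith)] at e2
    have := dist_triangle (γ r) (γ t) (δ r)
    rw [ht.2.2.2] at this e1
    linarith
  have s1 : IsGeodesicSegmentBetween (γ '' Set.Icc r (dist x y)) y (γ r) := by
    refine ⟨fun u => γ (dist x y - u), dist x y - r, by linarith, ?_, by simpa using hγ1,
      by simp, ?_⟩
    · intro u hu v hv
      rw [hγ _ ⟨by linarith [hu.2], by linarith [hu.1]⟩ _ ⟨by linarith [hv.2], by linarith [hv.1]⟩,
        abs_sub_comm]
      congr 1
      ring
    · ext p
      constructor
      · rintro ⟨u, hu, rfl⟩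
        exact ⟨dist x y - u, ⟨by linarith [hu.2], by linarith [hu.1]⟩, by simp⟩
      · rintro ⟨u, hu, rfl⟩
        exact ⟨dist x y - u, ⟨by linarith [hu.2], by linarith [hu.1]⟩, rfl⟩
  have s2 : IsGeodesicSegmentBetween (δ '' Set.Icc r (dist x z)) (γ r) z := by
    refine ⟨fun u => δ (u + r), dist x z - r, by linarith, ?_, by simp [hrS],
      by simpa using hδ1, ?_⟩
    · intro u hu v hv
      rw [hδ _ ⟨by linarith [hu.1], by linarith [hu.2]⟩ _ ⟨by linarith [hv.1], by linarith [hv.2]⟩]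
      congr 1
      ring
    · ext p
      constructor
      · rintro ⟨u, hu, rfl⟩
        exact ⟨u - r, ⟨by linarith [hu.1], by linarith [hu.2]⟩, by simp⟩
      · rintro ⟨u, hu, rfl⟩
        exact ⟨u + r, ⟨by linarith [hu.1], by linarith [hu.2]⟩, rfl⟩
  have s12 : γ '' Set.Icc r (dist x y) ∩ δ '' Set.Icc r (dist x z) = {γ r} := by
    ext p
    constructor
    · rintro ⟨⟨u, hu, rfl⟩, ⟨v, hv, huv⟩⟩
      have hu' : u ∈ Set.Icc 0 (dist x y) := ⟨by linarith [hu.1], hu.2⟩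
      have hv' : v ∈ Set.Icc 0 (dist x z) := ⟨by linarith [hv.1], hv.2⟩
      obtain rfl : v = u := by rw [← γx u hu', ← huv, δx v hv']
      have : v ≤ r := le_csSup hSb ⟨hu'.1, hu'.2, hv'.2, huv.symm⟩
      rw [Set.mem_singleton_iff, le_antisymm this hu.1]
    · rintro rfl
      exact ⟨⟨r, ⟨le_rfl, hry⟩, rfl⟩, ⟨r, ⟨le_rfl, hrz⟩, hrS.symm⟩⟩
  have s3 := hX.2 _ _ _ _ _ s1 s2 s12
  refine ⟨γ r, ?_, ?_, s3.dist_add_dist (Or.inl ⟨r, ⟨le_rfl, hry⟩, rfl⟩)⟩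
  · rw [γx r ⟨hr0, hry⟩, γy r ⟨hr0, hry⟩]; ring
  · rw [hrS, δx r ⟨hr0, hrz⟩, δz r ⟨hr0, hrz⟩]; ring

theorem IsRTree.isGeodesicZeroHyperbolic (hX : IsRTree X) : IsGeodesicZeroHyperbolic X := by
  refine ⟨hX.exists_between, fun x y z w => ?_⟩
  obtain ⟨m, hm1, hm2, hm3⟩ := hX.exists_median w x z
  obtain ⟨n, hn1, hn2, hn3⟩ := hX.exists_median w y z
  set t := min (dist w m) (dist w n) with ht
  have ht0 : 0 ≤ t := le_min dist_nonneg dist_nonneg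
  have htm : t ≤ dist w m := min_le_left _ _
  have htn : t ≤ dist w n := min_le_right _ _
  obtain ⟨p, hp1, hp2⟩ := hX.exists_between w m t ht0 htm
  obtain ⟨q, hq1, hq2⟩ := hX.exists_between w n t ht0 htn
  have hpz : dist w p + dist p z = dist w z := by
    have := dist_triangle p m z
    have := dist_triangle w p z
    linarith
  have hqz : dist w q + dist q z = dist w z := by
    have := dist_triangle q n z
    have := dist_triangle w q z
    linarith
  obtain rfl := hX.eq_of_dist_eq hpz hqz (by rw [hp1, hq1])
  have h1 := dist_triangle p m x
  have h2 := dist_triangle p n y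
  have h3 := dist_triangle x p y
  rw [dist_comm x p] at h3
  rw [dist_comm x m] at hm3
  rw [dist_comm y n] at hn3
  rw [dist_comm x w, dist_comm y w, dist_comm z w]
  rcases min_choice (dist w m) (dist w n) with h | h
  · refine le_trans ?_ (le_max_left _ _)
    linarith
  · refine le_trans ?_ (le_max_right _ _)
    linarith

end RTree

section Rays

variable {X : Type*}

/-- Two parametrized rays eventually agree up to a shift of the parameter. -/
def Asymptotic (γ δ : ℝ → X) : Prop :=
  ∃ k : ℝ, ∀ᶠ t in atTop, γ t = δ (t + k)

theorem Asymptotic.refl (γ : ℝ → X) : Asymptotic γ γ := ⟨0, by simp⟩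

theorem Asymptotic.symm {γ δ : ℝ → X} (h : Asymptotic γ δ) : Asymptotic δ γ := by
  obtain ⟨k, hk⟩ := h
  refine ⟨-k, ?_⟩
  filter_upwards [(tendsto_atTop_add_const_right atTop (-k) tendsto_id).eventually hk] with t ht
  simpa using ht.symm

theorem Asymptotic.trans {γ δ ε : ℝ → X} (h : Asymptotic γ δ) (h' : Asymptotic δ ε) :
    Asymptotic γ ε := by
  obtain ⟨k, hk⟩ := h
  obtain ⟨l, hl⟩ := h'
  refine ⟨k + l, ?_⟩
  filter_upwards [hk, (tendsto_atTop_add_const_right atTop k tendsto_id).eventually hl]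
    with t ht ht'
  rw [ht, ← add_assoc]
  exact ht'

theorem Asymptotic.map {γ δ : ℝ → X} (h : Asymptotic γ δ) (g : X → X) :
    Asymptotic (g ∘ γ) (g ∘ δ) := by
  obtain ⟨k, hk⟩ := h
  exact ⟨k, hk.mono fun t ht => congrArg g ht⟩

variable [MetricSpace X]

/-- `γ` restricts to an isometric embedding of `[0, ∞)`. -/
def IsometricRay (γ : ℝ → X) : Prop :=
  ∀ u ∈ Set.Ici (0 : ℝ), ∀ v ∈ Set.Ici (0 : ℝ), dist (γ u) (γ v) = |u - v|

/-- The end of `X` determined by a parametrized ray. -/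
def endOf (γ : ℝ → X) : Set (Set X) :=
  {R | IsRay R ∧ IsRay (R ∩ γ '' Set.Ici 0)}

namespace IsometricRay

theorem dist_of_le {γ : ℝ → X} (hγ : IsometricRay γ) {u v : ℝ} (hu : 0 ≤ u) (huv : u ≤ v) :
    dist (γ u) (γ v) = v - u := by
  rw [hγ u hu v (hu.trans huv), abs_of_nonpos (by linarith)]; ring

theorem isRay {γ : ℝ → X} (hγ : IsometricRay γ) : IsRay (γ '' Set.Ici 0) := ⟨γ, hγ, rfl⟩

theorem map {γ : ℝ → X} (hγ : IsometricRay γ) (g : X ≃ᵢ X) : IsometricRay (g ∘ γ) :=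
  fun u hu v hv => (g.dist_eq _ _).trans (hγ u hu v hv)

theorem shift {γ : ℝ → X} (hγ : IsometricRay γ) {k : ℝ} (hk : 0 ≤ k) :
    IsometricRay fun t => γ (k + t) := by
  intro u hu v hv
  rw [hγ _ (add_nonneg hk hu) _ (add_nonneg hk hv)]
  congr 1
  ring

theorem exists_eq_add {f : ℝ → ℝ} (h0 : ∀ u, 0 ≤ u → 0 ≤ f u)
    (h : ∀ u, 0 ≤ u → ∀ v, 0 ≤ v → |f u - f v| = |u - v|) : ∀ u, 0 ≤ u → f u = f 0 + u := by
  intro u hu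
  have h1 := h u hu 0 le_rfl
  have hf0 := h0 0 le_rfl
  rw [sub_zero, abs_of_nonneg hu] at h1
  have hv0 : 0 ≤ u + f 0 + 1 := by linarith
  have h2 := h _ hv0 0 le_rfl
  have h3 := h _ hv0 u hu
  rw [sub_zero, abs_of_nonneg hv0] at h2
  rw [abs_of_nonneg (by linarith : 0 ≤ u + f 0 + 1 - u)] at h3
  have h4 := h0 _ hv0
  rcases abs_cases (f u - f 0) with h5 | h5 <;>
    rcases abs_cases (f (u + f 0 + 1) - f 0) with h6 | h6 <;>
    rcases abs_cases (f (u + f 0 + 1) - f u) with h7 | h7 <;> linarith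

theorem asymptotic_of_isRay_inter {γ δ : ℝ → X} (hγ : IsometricRay γ) (hδ : IsometricRay δ)
    (h : IsRay (γ '' Set.Ici 0 ∩ δ '' Set.Ici 0)) : Asymptotic γ δ := by
  obtain ⟨σ, hσ, hσe⟩ := h
  have hmem : ∀ u : ℝ, 0 ≤ u → σ u ∈ γ '' Set.Ici 0 ∩ δ '' Set.Ici 0 := fun u hu => by
    rw [hσe]; exact ⟨u, hu, rfl⟩
  have h1 : ∀ u : ℝ, ∃ v : ℝ, 0 ≤ u → 0 ≤ v ∧ γ v = σ u := fun u => by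
    by_cases hu : 0 ≤ u
    · obtain ⟨v, hv, e⟩ := (hmem u hu).1
      exact ⟨v, fun _ => ⟨hv, e⟩⟩
    · exact ⟨0, fun h => absurd h hu⟩
  have h2 : ∀ u : ℝ, ∃ v : ℝ, 0 ≤ u → 0 ≤ v ∧ δ v = σ u := fun u => by
    by_cases hu : 0 ≤ u
    · obtain ⟨v, hv, e⟩ := (hmem u hu).2
      exact ⟨v, fun _ => ⟨hv, e⟩⟩
    · exact ⟨0, fun h => absurd h hu⟩
  choose f hf using h1
  choose f' hf' using h2
  have e1 := exists_eq_add (fun u hu => (hf u hu).1) fun u hu v hv => by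
    rw [← hγ _ (hf u hu).1 _ (hf v hv).1, (hf u hu).2, (hf v hv).2, hσ u hu v hv]
  have e2 := exists_eq_add (fun u hu => (hf' u hu).1) fun u hu v hv => by
    rw [← hδ _ (hf' u hu).1 _ (hf' v hv).1, (hf' u hu).2, (hf' v hv).2, hσ u hu v hv]
  refine ⟨f' 0 - f 0, ?_⟩
  filter_upwards [eventually_ge_atTop (f 0)] with t ht
  have hu : 0 ≤ t - f 0 := by linarith
  have a1 := (hf _ hu).2
  have a2 := (hf' _ hu).2
  rw [e1 _ hu] at a1
  rw [e2 _ hu] at a2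
  rw [show t = f 0 + (t - f 0) by ring, a1, ← a2]
  congr 1
  ring

end IsometricRay

namespace IsGeodesicZeroHyperbolic

theorem four_point_or (hX : IsGeodesicZeroHyperbolic X) (x y z w : X) :
    dist x y + dist z w ≤ dist x z + dist y w ∨ dist x y + dist z w ≤ dist x w + dist y z :=
  le_max_iff.1 (hX.four_point x y z w)

theorem eq_of_dist_eq (hX : IsGeodesicZeroHyperbolic X) {x y p q : X}
    (hp : dist x p + dist p y = dist x y) (hq : dist x q + dist q y = dist x y)
    (h : dist x p = dist x q) : p = q := by
  refine dist_le_zero.1 ?_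
  rcases hX.four_point_or p q x y with h1 | h1 <;>
    linarith [dist_comm p x, dist_comm q x]

theorem exists_segment (hX : IsGeodesicZeroHyperbolic X) (x y : X) : ∃ p : ℝ → X,
    (∀ t, 0 ≤ t → t ≤ dist x y → dist x (p t) = t ∧ dist (p t) y = dist x y - t) ∧
    ∀ s, 0 ≤ s → ∀ t, s ≤ t → t ≤ dist x y → dist (p s) (p t) = t - s := by
  have h : ∀ t : ℝ, ∃ p, 0 ≤ t → t ≤ dist x y → dist x p = t ∧ dist p y = dist x y - t := by
    intro t
    by_cases ht : 0 ≤ t ∧ t ≤ dist x y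
    · obtain ⟨p, hp⟩ := hX.exists_between x y t ht.1 ht.2
      exact ⟨p, fun _ _ => hp⟩
    · exact ⟨x, fun h1 h2 => absurd ⟨h1, h2⟩ ht⟩
  choose p hp using h
  refine ⟨p, hp, fun s hs t hst ht => ?_⟩
  obtain ⟨h1, h2⟩ := hp s hs (hst.trans ht)
  obtain ⟨h3, h4⟩ := hp t (hs.trans hst) ht
  have h5 := dist_triangle x (p s) (p t)
  rcases hX.four_point_or (p s) (p t) x y with h6 | h6 <;>
    linarith [dist_comm (p s) x, dist_comm (p t) x]

/-- Concatenation of a segment with a ray. -/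
theorem exists_ray_of_dist_eq (hX : IsGeodesicZeroHyperbolic X) {γ : ℝ → X}
    (hγ : IsometricRay γ) {x : X} {T c : ℝ} (hT : 0 ≤ T)
    (h : ∀ s, T ≤ s → dist x (γ s) = s + c) :
    ∃ δ : ℝ → X, IsometricRay δ ∧ δ 0 = x ∧ ∀ t, T + c ≤ t → δ t = γ (t - c) := by
  obtain ⟨p, hp, hpd⟩ := hX.exists_segment x (γ T)
  have hD := h T le_rfl
  have hD0 := dist_nonneg (x := x) (y := γ T)
  rw [hD] at hp hpd hD0
  have key : ∀ u v, 0 ≤ u → u ≤ v →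
      dist (if u < T + c then p u else γ (u - c)) (if v < T + c then p v else γ (v - c)) =
        v - u := by
    intro u v hu huv
    split_ifs with h1 h2 h2
    · exact hpd u hu v huv h2.le
    · have a1 := hp u hu h1.le
      have a2 := h (v - c) (by linarith)
      have a3 := hγ.dist_of_le hT (show T ≤ v - c by linarith)
      have a4 := dist_triangle (p u) (γ T) (γ (v - c))
      have a5 := dist_triangle x (p u) (γ (v - c))
      linarith
    · linarith
    · rw [hγ.dist_of_le (by linarith) (by linarith)]
      ring
  refine ⟨fun t => if t < T + c then p t else γ (t - c), ?_, ?_, ?_⟩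
  · intro u hu v hv
    dsimp only
    rcases le_total u v with huv | huv
    · rw [key u v hu huv, abs_of_nonpos (by linarith)]; ring
    · rw [dist_comm, key v u hv huv, abs_of_nonneg (by linarith)]
  · dsimp only
    split_ifs with h1
    · exact (dist_eq_zero.1 (hp 0 le_rfl h1.le).1).symm
    · have := h (0 - c) (by linarith)
      exact (dist_eq_zero.1 (by linarith)).symm
  · intro t ht
    exact if_neg (by linarith)

theorem exists_ray_from (hX : IsGeodesicZeroHyperbolic X) {γ : ℝ → X} (hγ : IsometricRay γ)
    (x : X) : ∃ δ : ℝ → X, IsometricRay δ ∧ δ 0 = x ∧ Asymptotic δ γ := by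
  set T := dist x (γ 0) + 1 with hT
  have hd := dist_nonneg (x := x) (y := γ 0)
  have hT0 : 0 ≤ T := by linarith
  obtain ⟨δ, h1, h2, h3⟩ := hX.exists_ray_of_dist_eq (x := x) (T := T)
    (c := dist x (γ T) - T) hγ hT0
    (fun s hs => by
      have e1 := hγ.dist_of_le le_rfl (hT0.trans hs)
      have e2 := hγ.dist_of_le hT0 hs
      have e3 := hγ.dist_of_le le_rfl hT0
      have e4 := dist_triangle x (γ T) (γ s)
      have e5 := dist_nonneg (x := x) (y := γ T)
      rcases hX.four_point_or x (γ T) (γ 0) (γ s) with h6 | h6 <;>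
        linarith [dist_comm (γ T) (γ 0)])
  refine ⟨δ, h1, h2, -(dist x (γ T) - T), ?_⟩
  filter_upwards [eventually_ge_atTop (T + (dist x (γ T) - T))] with t ht
  rw [h3 t ht, sub_eq_add_neg]

theorem ray_eqOn (hX : IsGeodesicZeroHyperbolic X) {γ δ : ℝ → X} (hγ : IsometricRay γ)
    (hδ : IsometricRay δ) {a b u v : ℝ} (ha : 0 ≤ a) (hb : 0 ≤ b) (hu : 0 ≤ u) (huv : u ≤ v)
    (h0 : γ a = δ b) (h1 : γ (a + v) = δ (b + v)) : γ (a + u) = δ (b + u) := by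
  refine hX.eq_of_dist_eq (x := γ a) (y := γ (a + v)) ?_ ?_ ?_
  · rw [hγ.dist_of_le ha (by linarith), hγ.dist_of_le (by linarith) (by linarith),
      hγ.dist_of_le ha (by linarith)]
    ring
  · rw [h0, h1, hδ.dist_of_le hb (by linarith), hδ.dist_of_le (by linarith) (by linarith),
      hδ.dist_of_le hb (by linarith)]
    ring
  · rw [hγ.dist_of_le ha (by linarith), h0, hδ.dist_of_le hb (by linarith)]
    ring

theorem ray_eq_of_le (hX : IsGeodesicZeroHyperbolic X) {γ δ : ℝ → X} (hγ : IsometricRay γ)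
    (hδ : IsometricRay δ) (h0 : γ 0 = δ 0) {u v : ℝ} (hu : 0 ≤ u) (huv : u ≤ v)
    (h1 : γ v = δ v) : γ u = δ u := by
  simpa using hX.ray_eqOn hγ hδ le_rfl le_rfl hu huv h0 (by simpa using h1)

theorem eq_of_asymptotic (hX : IsGeodesicZeroHyperbolic X) {γ δ : ℝ → X} (hγ : IsometricRay γ)
    (hδ : IsometricRay δ) (h0 : γ 0 = δ 0) (h : Asymptotic γ δ) {u : ℝ} (hu : 0 ≤ u) :
    γ u = δ u := by
  obtain ⟨k, hk⟩ := h
  obtain ⟨t, ht, ht1, ht2⟩ := (hk.and ((eventually_ge_atTop u).and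
    (eventually_ge_atTop (-k)))).exists
  have e1 := hγ.dist_of_le le_rfl (hu.trans ht1)
  have e2 := hδ.dist_of_le le_rfl (show 0 ≤ t + k by linarith)
  rw [← h0, ← ht] at e2
  obtain rfl : k = 0 := by linarith
  exact hX.ray_eq_of_le hγ hδ h0 hu ht1 (by simpa using ht)

theorem isRay_inter (hX : IsGeodesicZeroHyperbolic X) {γ δ : ℝ → X} (hγ : IsometricRay γ)
    (hδ : IsometricRay δ) (h : Asymptotic γ δ) : IsRay (γ '' Set.Ici 0 ∩ δ '' Set.Ici 0) := by
  obtain ⟨k, hk⟩ := h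
  obtain ⟨T, hT⟩ := eventually_atTop.1 hk
  set S : Set ℝ := {s | 0 ≤ s ∧ 0 ≤ s + k ∧ γ s = δ (s + k)} with hS
  have hup : ∀ s ∈ S, ∀ u, s ≤ u → u ∈ S := by
    rintro s ⟨h1, h2, h3⟩ u hu
    refine ⟨by linarith, by linarith, ?_⟩
    have h4 := hT (s + max (u - s) (T - s)) (by linarith [le_max_right (u - s) (T - s)])
    have := hX.ray_eqOn (u := u - s) (v := max (u - s) (T - s)) hγ hδ h1 h2 (by linarith)
      (le_max_left _ _) h3 (by rw [h4]; congr 1; ring)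
    rw [show u = s + (u - s) by ring, this]
    congr 1
    ring
  have hST : max T (max 0 (-k)) ∈ S := by
    have h1 := le_max_right T (max 0 (-k))
    have h2 := le_max_left 0 (-k)
    have h3 := le_max_right 0 (-k)
    exact ⟨by linarith, by linarith, hT _ (le_max_left _ _)⟩
  have hSb : BddBelow S := ⟨0, fun s hs => hs.1⟩
  set r := sInf S with hr
  have hr0 : 0 ≤ r := le_csInf ⟨_, hST⟩ fun s hs => hs.1
  have hrk : 0 ≤ r + k := by
    have : -k ≤ r := le_csInf ⟨_, hST⟩ fun s hs => by linarith [hs.2.1]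
    linarith
  have hrS : r ∈ S := by
    refine ⟨hr0, hrk, dist_le_zero.1 (le_of_forall_pos_le_add fun ε hε => ?_)⟩
    obtain ⟨t, ht, hlt⟩ := exists_lt_of_csInf_lt ⟨_, hST⟩ (show sInf S < r + ε / 2 by linarith)
    have htr : r ≤ t := csInf_le hSb ht
    have e1 := hγ.dist_of_le hr0 htr
    have e2 := hδ.dist_of_le hrk (show r + k ≤ t + k by linarith)
    have := dist_triangle_right (γ r) (δ (r + k)) (γ t)
    rw [ht.2.2] at this e1
    linarith
  refine ⟨fun t => γ (r + t), hγ.shift hr0, ?_⟩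
  ext p
  constructor
  · rintro ⟨⟨s, hs, rfl⟩, v, hv, hsv⟩
    rw [Set.mem_Ici] at hs hv
    have hsS : s ∈ S := by
      set t := max (max T (max 0 (-k))) (max s v - min 0 k) with ht
      have h1 : max T (max 0 (-k)) ≤ t := le_max_left _ _
      have h2 : max s v - min 0 k ≤ t := le_max_right _ _
      have h3 := le_max_left s v
      have h4 := le_max_right s v
      have h5 := min_le_left 0 k
      have h6 := min_le_right 0 k
      have h7 := (hup _ hST t h1).2.2
      have e1 := hγ.dist_of_le hs (show s ≤ t by linarith)
      have e2 := hδ.dist_of_le hv (show v ≤ t + k by linarith)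
      rw [hsv, ← h7] at e2
      have : v = s + k := by linarith
      subst this
      exact ⟨hs, hv, hsv.symm⟩
    exact ⟨s - r, sub_nonneg.2 (csInf_le hSb hsS), by simp⟩
  · rintro ⟨t, ht, rfl⟩
    rw [Set.mem_Ici] at ht
    obtain ⟨h1, h2, h3⟩ := hup r hrS (r + t) (by linarith)
    exact ⟨⟨_, h1, rfl⟩, ⟨_, h2, h3.symm⟩⟩

theorem isRay_inter_iff (hX : IsGeodesicZeroHyperbolic X) {γ δ : ℝ → X} (hγ : IsometricRay γ)
    (hδ : IsometricRay δ) : IsRay (γ '' Set.Ici 0 ∩ δ '' Set.Ici 0) ↔ Asymptotic γ δ :=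
  ⟨hγ.asymptotic_of_isRay_inter hδ, hX.isRay_inter hγ hδ⟩

theorem endOf_eq_iff (hX : IsGeodesicZeroHyperbolic X) {γ δ : ℝ → X} (hγ : IsometricRay γ)
    (hδ : IsometricRay δ) : endOf γ = endOf δ ↔ Asymptotic γ δ := by
  constructor
  · intro h
    have : γ '' Set.Ici 0 ∈ endOf δ := by
      rw [← h]
      exact ⟨hγ.isRay, (hX.isRay_inter_iff hγ hγ).2 (.refl γ)⟩
    exact (hX.isRay_inter_iff hγ hδ).1 this.2
  · intro h
    ext R
    refine and_congr_right ?_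
    rintro ⟨ρ, hρ, rfl⟩
    change IsometricRay ρ at hρ
    rw [hX.isRay_inter_iff hρ hγ, hX.isRay_inter_iff hρ hδ]
    exact ⟨fun h' => h'.trans h, fun h' => h'.trans h.symm⟩

end IsGeodesicZeroHyperbolic

theorem isEnd_iff {e : Set (Set X)} : IsEnd e ↔ ∃ γ : ℝ → X, IsometricRay γ ∧ e = endOf γ := by
  constructor
  · rintro ⟨R, ⟨γ, hγ, rfl⟩, rfl⟩
    exact ⟨γ, hγ, rfl⟩
  · rintro ⟨γ, hγ, rfl⟩
    exact ⟨_, hγ.isRay, rfl⟩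

theorem IsRay.image {R : Set X} (hR : IsRay R) (g : X ≃ᵢ X) : IsRay (g '' R) := by
  obtain ⟨γ, hγ, rfl⟩ := hR
  exact ⟨g ∘ γ, IsometricRay.map hγ g, (Set.image_comp g γ _).symm⟩

theorem isRay_image_iff {R : Set X} (g : X ≃ᵢ X) : IsRay (g '' R) ↔ IsRay R := by
  refine ⟨fun h => ?_, fun h => h.image g⟩
  simpa [Set.image_image] using h.image g.symm

theorem pushEnd_endOf (g : X ≃ᵢ X) (γ : ℝ → X) : pushEnd g (endOf γ) = endOf (g ∘ γ) := by
  ext R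
  constructor
  · rintro ⟨R, ⟨h1, h2⟩, rfl⟩
    refine ⟨h1.image g, ?_⟩
    rw [Set.image_comp, ← Set.image_inter g.injective]
    exact h2.image g
  · rintro ⟨h1, h2⟩
    obtain ⟨R, rfl⟩ := Set.image_surjective.2 g.surjective R
    rw [Set.image_comp, ← Set.image_inter g.injective] at h2
    exact ⟨R, ⟨(isRay_image_iff g).1 h1, (isRay_image_iff g).1 h2⟩, rfl⟩

theorem IsGeodesicZeroHyperbolic.pushEnd_endOf_eq_iff (hX : IsGeodesicZeroHyperbolic X)
    {γ δ : ℝ → X} (hγ : IsometricRay γ) (hδ : IsometricRay δ) (g : X ≃ᵢ X) :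
    pushEnd g (endOf γ) = endOf δ ↔ Asymptotic (g ∘ γ) δ := by
  rw [pushEnd_endOf, hX.endOf_eq_iff (hγ.map g) hδ]

end Rays

section Ends

variable {X : Type*} [MetricSpace X]

namespace IsGeodesicZeroHyperbolic

theorem dist_ray_of_ne (hX : IsGeodesicZeroHyperbolic X) {γ δ : ℝ → X} (hγ : IsometricRay γ)
    (hδ : IsometricRay δ) (h0 : γ 0 = δ 0) {r : ℝ} (hr : 0 ≤ r) (hne : γ r ≠ δ r) {s t : ℝ}
    (hs : r ≤ s) (ht : r ≤ t) :
    dist (γ s) (δ t) = (s - r) + (t - r) + dist (γ r) (δ r) := by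
  have hd := dist_pos.2 hne
  have e1 := hγ.dist_of_le le_rfl hr
  have e2 := hδ.dist_of_le le_rfl hr
  have e3 := hγ.dist_of_le le_rfl (hr.trans hs)
  have e4 := hδ.dist_of_le le_rfl (hr.trans ht)
  have e5 := hγ.dist_of_le hr hs
  have e6 := hδ.dist_of_le hr ht
  rw [← h0] at e2 e4
  have h1 : s - r + dist (γ r) (δ r) ≤ dist (γ s) (δ r) := by
    rcases hX.four_point_or (γ 0) (γ s) (γ r) (δ r) with h | h <;>
      linarith [dist_comm (γ s) (γ r)]
  have h2 : (s - r) + (t - r) + dist (γ r) (δ r) ≤ dist (γ s) (δ t) := by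
    rcases hX.four_point_or (γ 0) (δ t) (δ r) (γ s) with h | h <;>
      linarith [dist_comm (γ s) (δ t), dist_comm (γ s) (δ r), dist_comm (δ t) (δ r)]
  have h3 := dist_triangle4 (γ s) (γ r) (δ r) (δ t)
  linarith [dist_comm (γ s) (γ r)]

theorem dist_ray_of_forall_ne (hX : IsGeodesicZeroHyperbolic X) {γ δ : ℝ → X}
    (hγ : IsometricRay γ) (hδ : IsometricRay δ) (h0 : γ 0 = δ 0)
    (hne : ∀ r, 0 < r → γ r ≠ δ r) {s t : ℝ} (hs : 0 ≤ s) (ht : 0 ≤ t) :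
    dist (γ s) (δ t) = s + t := by
  have e1 := hγ.dist_of_le le_rfl hs
  have e2 := hδ.dist_of_le le_rfl ht
  have e3 := dist_triangle (γ s) (γ 0) (δ t)
  rw [dist_comm (γ s) (γ 0), e1, h0, e2] at e3
  refine le_antisymm (by linarith) ?_
  rcases hs.eq_or_lt with rfl | hs
  · rw [h0, e2]; linarith
  rcases ht.eq_or_lt with rfl | ht
  · rw [← h0, dist_comm, e1]; linarith
  refine le_of_forall_pos_le_add fun ε hε => ?_
  set r := min (ε / 2) (min s t) with hr
  have h1 : r ≤ ε / 2 := min_le_left _ _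
  have h2 : r ≤ s := (min_le_right _ _).trans (min_le_left _ _)
  have h3 : r ≤ t := (min_le_right _ _).trans (min_le_right _ _)
  have h4 : 0 < r := lt_min (by linarith) (lt_min hs ht)
  have := hX.dist_ray_of_ne hγ hδ h0 h4.le (hne r h4) h2 h3
  have := dist_nonneg (x := γ r) (y := δ r)
  linarith

theorem exists_dist_ray_eq (hX : IsGeodesicZeroHyperbolic X) {γ δ : ℝ → X}
    (hγ : IsometricRay γ) (hδ : IsometricRay δ) (h : ¬ Asymptotic γ δ) :
    ∃ C T : ℝ, 0 ≤ T ∧ ∀ s, T ≤ s → ∀ t, T ≤ t → dist (γ s) (δ t) = s + t - C := by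
  obtain ⟨σ, hσ, hσ0, hσδ⟩ := hX.exists_ray_from hδ (γ 0)
  have hr : ∃ r, 0 ≤ r ∧ γ r ≠ σ r := by
    by_contra! hcon
    refine h (Asymptotic.trans ⟨0, ?_⟩ hσδ)
    filter_upwards [eventually_ge_atTop 0] with t ht
    rw [add_zero, hcon t ht]
  obtain ⟨r, hr0, hr⟩ := hr
  obtain ⟨k, hk⟩ := hσδ.symm
  obtain ⟨T, hT⟩ := eventually_atTop.1 hk
  refine ⟨2 * r - k - dist (γ r) (σ r), max T (max r (r - k)), ?_, fun s hs t ht => ?_⟩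
  · exact hr0.trans ((le_max_left _ _).trans (le_max_right _ _))
  · have h1 := le_max_left T (max r (r - k))
    have h2 := le_max_right T (max r (r - k))
    have h3 := le_max_left r (r - k)
    have h4 := le_max_right r (r - k)
    rw [hT t (by linarith), hX.dist_ray_of_ne hγ hσ hσ0.symm hr0 hr (by linarith) (by linarith)]
    ring

theorem exists_median (hX : IsGeodesicZeroHyperbolic X) (x y z : X) : ∃ m,
    dist m x = (dist x y + dist x z - dist y z) / 2 ∧
    dist m y = (dist x y + dist y z - dist x z) / 2 ∧
    dist m z = (dist x z + dist y z - dist x y) / 2 := by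
  have h1 := dist_triangle x y z
  have h2 := dist_triangle y x z
  have h3 := dist_triangle x z y
  rw [dist_comm y x] at h2
  rw [dist_comm z y] at h3
  obtain ⟨m, hm1, hm2⟩ := hX.exists_between x y ((dist x y + dist x z - dist y z) / 2)
    (by linarith) (by linarith)
  have h4 := dist_triangle x m z
  refine ⟨m, by rw [dist_comm, hm1], by rw [hm2]; ring, ?_⟩
  rcases hX.four_point_or m z x y with h | h <;>
    linarith [dist_comm m x, dist_comm z x, dist_comm z y]

theorem exists_ray_from_of_dist_eq (hX : IsGeodesicZeroHyperbolic X) {γ : ℝ → X}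
    (hγ : IsometricRay γ) {m : X} {k T : ℝ} (hT : 0 ≤ T)
    (h : ∀ s, T ≤ s → dist m (γ s) = s - k) :
    ∃ δ, IsometricRay δ ∧ δ 0 = m ∧ Asymptotic δ γ ∧ ∀ t, T - k ≤ t → δ t = γ (t + k) := by
  obtain ⟨δ, h1, h2, h3⟩ := hX.exists_ray_of_dist_eq hγ (c := -k) hT
    (fun s hs => by rw [h s hs]; ring)
  have h4 : ∀ t, T - k ≤ t → δ t = γ (t + k) := fun t ht => by
    rw [h3 t (by linarith), sub_neg_eq_add]
  exact ⟨δ, h1, h2, ⟨k, eventually_atTop.2 ⟨_, h4⟩⟩, h4⟩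

theorem ray_ne_of_dist_eq {γ δ : ℝ → X} (hγ : IsometricRay γ) (hδ : IsometricRay δ) {T : ℝ}
    (h : ∀ s, T ≤ s → dist (γ s) (δ s) = s + s) (r : ℝ) (hr : 0 < r) : γ r ≠ δ r := by
  intro hrd
  have h1 := hγ.dist_of_le hr.le (le_max_right T r)
  have h2 := hδ.dist_of_le hr.le (le_max_right T r)
  have h3 := h _ (le_max_left T r)
  have h4 := dist_triangle_left (γ (max T r)) (δ (max T r)) (γ r)
  rw [h1, h3, hrd, h2] at h4
  linarith

/-- Three distinct ends have a center. -/
theorem exists_center (hX : IsGeodesicZeroHyperbolic X) {α β γ : ℝ → X} (hα : IsometricRay α)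
    (hβ : IsometricRay β) (hγ : IsometricRay γ) (hαβ : ¬ Asymptotic α β)
    (hαγ : ¬ Asymptotic α γ) (hβγ : ¬ Asymptotic β γ) :
    ∃ (m : X) (α' β' γ' : ℝ → X), IsometricRay α' ∧ IsometricRay β' ∧ IsometricRay γ' ∧
      α' 0 = m ∧ β' 0 = m ∧ γ' 0 = m ∧
      Asymptotic α' α ∧ Asymptotic β' β ∧ Asymptotic γ' γ ∧
      (∀ r, 0 < r → α' r ≠ β' r) ∧ (∀ r, 0 < r → α' r ≠ γ' r) ∧
      (∀ r, 0 < r → β' r ≠ γ' r) := by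
  obtain ⟨C₁, T₁, hT₁, h₁⟩ := hX.exists_dist_ray_eq hα hβ hαβ
  obtain ⟨C₂, T₂, hT₂, h₂⟩ := hX.exists_dist_ray_eq hα hγ hαγ
  obtain ⟨C₃, T₃, hT₃, h₃⟩ := hX.exists_dist_ray_eq hβ hγ hβγ
  obtain ⟨T, t₁, t₂, t₃⟩ : ∃ T, T₁ ≤ T ∧ T₂ ≤ T ∧ T₃ ≤ T :=
    ⟨max T₁ (max T₂ T₃), le_max_left _ _, (le_max_left _ _).trans (le_max_right _ _),
      (le_max_right _ _).trans (le_max_right _ _)⟩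
  have hT : 0 ≤ T := hT₁.trans t₁
  obtain ⟨m, hma, hmb, hmc⟩ := hX.exists_median (α T) (β T) (γ T)
  rw [h₁ T t₁ T t₁, h₂ T t₂ T t₂, h₃ T t₃ T t₃] at hma hmb hmc
  obtain ⟨α', hα', hα'0, hα'a, hα's⟩ := hX.exists_ray_from_of_dist_eq (m := m)
    (k := (C₁ + C₂ - C₃) / 2) (T := T) hα hT (fun s hs => by
      have e1 := h₁ s (by linarith) T t₁
      have e2 := hα.dist_of_le hT hs
      have e3 := dist_triangle_left (α s) (β T) m
      have e4 := dist_triangle m (α T) (α s)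
      linarith)
  obtain ⟨β', hβ', hβ'0, hβ'a, hβ's⟩ := hX.exists_ray_from_of_dist_eq (m := m)
    (k := (C₁ + C₃ - C₂) / 2) (T := T) hβ hT (fun s hs => by
      have e1 := h₁ T t₁ s (by linarith)
      have e2 := hβ.dist_of_le hT hs
      have e3 := dist_triangle_left (α T) (β s) m
      have e4 := dist_triangle m (β T) (β s)
      linarith)
  obtain ⟨γ', hγ', hγ'0, hγ'a, hγ's⟩ := hX.exists_ray_from_of_dist_eq (m := m)
    (k := (C₂ + C₃ - C₁) / 2) (T := T) hγ hT (fun s hs => by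
      have e1 := h₂ T t₂ s (by linarith)
      have e2 := hγ.dist_of_le hT hs
      have e3 := dist_triangle_left (α T) (γ s) m
      have e4 := dist_triangle m (γ T) (γ s)
      linarith)
  refine ⟨m, α', β', γ', hα', hβ', hγ', hα'0, hβ'0, hγ'0, hα'a, hβ'a, hγ'a, ?_, ?_, ?_⟩
  · refine ray_ne_of_dist_eq hα' hβ' (T := max (T - (C₁ + C₂ - C₃) / 2) (T - (C₁ + C₃ - C₂) / 2))
      fun s hs => ?_
    have a1 := (le_max_left _ _).trans hs
    have a2 := (le_max_right _ _).trans hs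
    rw [hα's s a1, hβ's s a2, h₁ _ (by linarith) _ (by linarith)]
    ring
  · refine ray_ne_of_dist_eq hα' hγ' (T := max (T - (C₁ + C₂ - C₃) / 2) (T - (C₂ + C₃ - C₁) / 2))
      fun s hs => ?_
    have a1 := (le_max_left _ _).trans hs
    have a2 := (le_max_right _ _).trans hs
    rw [hα's s a1, hγ's s a2, h₂ _ (by linarith) _ (by linarith)]
    ring
  · refine ray_ne_of_dist_eq hβ' hγ' (T := max (T - (C₁ + C₃ - C₂) / 2) (T - (C₂ + C₃ - C₁) / 2))
      fun s hs => ?_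
    have a1 := (le_max_left _ _).trans hs
    have a2 := (le_max_right _ _).trans hs
    rw [hβ's s a1, hγ's s a2, h₃ _ (by linarith) _ (by linarith)]
    ring

theorem apply_eq_of_fixes_line (hX : IsGeodesicZeroHyperbolic X) {α β : ℝ → X}
    (hα : IsometricRay α) (hβ : IsometricRay β) (h0 : α 0 = β 0)
    (hne : ∀ r, 0 < r → α r ≠ β r) {g : X ≃ᵢ X} (hgα : Asymptotic (g ∘ α) α)
    (hgβ : Asymptotic (g ∘ β) β) {x : X} (hx : g x = x) : g (α 0) = α 0 := by
  have key : ∀ γ : ℝ → X, IsometricRay γ → Asymptotic (g ∘ γ) γ →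
      (∀ s, 0 ≤ s → dist x (γ s) = dist x (γ 0) + s) → g (γ 0) = γ 0 := by
    intro γ hγ hgγ h
    obtain ⟨δ, hδ, hδ0, hδγ, hδs⟩ := hX.exists_ray_from_of_dist_eq (m := x)
      (k := -dist x (γ 0)) (T := 0) hγ le_rfl (fun s hs => by rw [h s hs]; ring)
    have h1 : Asymptotic (g ∘ δ) δ := ((hδγ.map g).trans hgγ).trans hδγ.symm
    have h2 := hX.eq_of_asymptotic (hδ.map g) hδ (by simp [hδ0, hx]) h1
      (dist_nonneg (x := x) (y := γ 0))
    rw [Function.comp_apply, hδs _ (by linarith), add_neg_cancel] at h2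
    exact h2
  by_cases h : ∀ s, 0 ≤ s → dist x (α s) = dist x (α 0) + s
  · exact key α hα hgα h
  · push Not at h
    obtain ⟨s, hs, hne'⟩ := h
    rw [h0]
    refine key β hβ hgβ fun t ht => ?_
    have e1 := hα.dist_of_le le_rfl hs
    have e2 := hβ.dist_of_le le_rfl ht
    have e3 := hX.dist_ray_of_forall_ne hα hβ h0 hne hs ht
    have e4 := dist_triangle x (β 0) (β t)
    have e5 := dist_triangle x (α 0) (α s)
    have e6 := lt_of_le_of_ne e5 (by rwa [e1, sub_zero])
    rw [← h0] at e2 e4 ⊢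
    rcases hX.four_point_or x (α 0) (α s) (β t) with h | h <;> linarith

end IsGeodesicZeroHyperbolic

/-- `ℓ` is a line translated by `τ > 0` by the isometry `u`. -/
structure IsAxis (u : X ≃ᵢ X) (ℓ : ℝ → X) (τ : ℝ) : Prop where
  pos : 0 < τ
  dist_eq : ∀ s t, dist (ℓ s) (ℓ t) = |s - t|
  map_eq : ∀ t, u (ℓ t) = ℓ (t + τ)

namespace IsAxis

variable {u : X ≃ᵢ X} {ℓ : ℝ → X} {τ : ℝ}

theorem inv (h : IsAxis u ℓ τ) : IsAxis u⁻¹ (fun t => ℓ (-t)) τ := by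
  refine ⟨h.pos, fun s t => ?_, fun t => ?_⟩
  · rw [h.dist_eq, abs_sub_comm]
    congr 1
    ring
  · have := h.map_eq (-(t + τ))
    rw [show -(t + τ) + τ = -t by ring] at this
    rw [← this]
    exact u.symm_apply_apply _

theorem pow_map_eq (h : IsAxis u ℓ τ) (n : ℕ) (t : ℝ) : (u ^ n) (ℓ t) = ℓ (t + n * τ) := by
  induction n with
  | zero => simp
  | succ n ih =>
    rw [pow_succ', IsometryEquiv.mul_apply, ih, h.map_eq]
    congr 1
    push_cast
    ring

theorem isometricRay (h : IsAxis u ℓ τ) : IsometricRay ℓ := fun s _ t _ => h.dist_eq s t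

theorem asymptotic_map (h : IsAxis u ℓ τ) : Asymptotic (u ∘ ℓ) ℓ :=
  ⟨τ, Eventually.of_forall h.map_eq⟩

theorem asymptotic_map_neg (h : IsAxis u ℓ τ) :
    Asymptotic (u ∘ fun t => ℓ (-t)) (fun t => ℓ (-t)) := by
  refine ⟨-τ, Eventually.of_forall fun t => ?_⟩
  change u (ℓ (-t)) = ℓ (-(t + -τ))
  rw [h.map_eq]
  congr 1
  ring

theorem not_asymptotic (h : IsAxis u ℓ τ) : ¬ Asymptotic ℓ (fun t => ℓ (-t)) := by
  rintro ⟨k, hk⟩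
  obtain ⟨t, ht, htk⟩ := (hk.and (eventually_gt_atTop (-k / 2))).exists
  have := h.dist_eq t (-(t + k))
  rw [show ℓ t = ℓ (-(t + k)) from ht, dist_self] at this
  have := abs_eq_zero.1 this.symm
  linarith

theorem asymptotic_or (hX : IsGeodesicZeroHyperbolic X) (h : IsAxis u ℓ τ) {ρ : ℝ → X}
    (hρ : IsometricRay ρ) (hu : Asymptotic (u ∘ ρ) ρ) :
    Asymptotic ρ ℓ ∨ Asymptotic ρ (fun t => ℓ (-t)) := by
  by_contra! hcon
  obtain ⟨C, T, -, hC⟩ := hX.exists_dist_ray_eq hρ h.isometricRay hcon.1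
  obtain ⟨C', T', -, hC'⟩ := hX.exists_dist_ray_eq hρ h.inv.isometricRay hcon.2
  obtain ⟨k, hk⟩ := hu
  obtain ⟨t, ht, ht1, ht2, ht3⟩ := (hk.and ((eventually_ge_atTop (|T| + |T'| + |k| + τ)).and
    ((eventually_ge_atTop (|T| + |T'| - k)).and (eventually_ge_atTop (|T| + |T'| + τ))))).exists
  have hτ := h.pos
  have a1 := le_abs_self T
  have a2 := le_abs_self T'
  have a3 := abs_nonneg k
  have a4 := abs_nonneg T
  have a5 := abs_nonneg T'
  have e1 := u.dist_eq (ρ t) (ℓ t)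
  have e2 := u.dist_eq (ρ t) (ℓ (-t))
  rw [h.map_eq, show u (ρ t) = ρ (t + k) from ht] at e1 e2
  rw [hC _ (by linarith) _ (by linarith), hC _ (by linarith) _ (by linarith)] at e1
  rw [show -t + τ = -(t - τ) by ring, hC' _ (by linarith) _ (by linarith),
    hC' _ (by linarith) _ (by linarith)] at e2
  linarith

end IsAxis

namespace IsGeodesicZeroHyperbolic

theorem dist_iterate_eq (hX : IsGeodesicZeroHyperbolic X) {u : X ≃ᵢ X} {m : X} {τ : ℝ}
    (hτ : 0 < τ) (h1 : dist m (u m) = τ) (h2 : dist m (u (u m)) = 2 * τ) (n : ℕ) :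
    dist m ((u ^ n) m) = n * τ ∧ dist m ((u ^ (n + 1)) m) = (n + 1) * τ := by
  induction n with
  | zero => simp [h1]
  | succ n ih =>
    obtain ⟨ih1, ih2⟩ := ih
    refine ⟨by rw [ih2]; push_cast; ring, ?_⟩
    have e1 : dist ((u ^ n) m) ((u ^ (n + 1)) m) = τ := by
      rw [pow_succ, IsometryEquiv.mul_apply, (u ^ n).dist_eq, h1]
    have e2 : dist ((u ^ (n + 1)) m) ((u ^ (n + 1 + 1)) m) = τ := by
      rw [pow_succ u (n + 1), IsometryEquiv.mul_apply, (u ^ (n + 1)).dist_eq, h1]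
    have e3 : dist ((u ^ n) m) ((u ^ (n + 1 + 1)) m) = 2 * τ := by
      rw [pow_succ u (n + 1), pow_succ u n, IsometryEquiv.mul_apply, IsometryEquiv.mul_apply,
        (u ^ n).dist_eq, h2]
    have e4 := dist_triangle m ((u ^ (n + 1)) m) ((u ^ (n + 1 + 1)) m)
    push_cast
    rcases hX.four_point_or m ((u ^ (n + 1)) m) ((u ^ n) m) ((u ^ (n + 1 + 1)) m) with h | h <;>
      linarith [dist_comm ((u ^ n) m) ((u ^ (n + 1)) m)]

theorem exists_isAxis_of_dist (hX : IsGeodesicZeroHyperbolic X) {u : X ≃ᵢ X} {m : X} {τ : ℝ}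
    (hτ : 0 < τ) (h1 : dist m (u m) = τ) (h2 : dist m (u (u m)) = 2 * τ) :
    ∃ ℓ, IsAxis u ℓ τ := by
  obtain ⟨p, hp, hpd⟩ := hX.exists_segment m (u m)
  rw [h1] at hp hpd
  have hb : ∀ j k : ℤ, j ≤ k → dist ((u ^ j) m) ((u ^ k) m) = (k - j) * τ := by
    intro j k hjk
    obtain ⟨n, rfl⟩ := Int.le.dest hjk
    rw [zpow_add, IsometryEquiv.mul_apply, (u ^ j).dist_eq, zpow_natCast,
      (hX.dist_iterate_eq hτ h1 h2 n).1]
    push_cast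
    ring
  set ℓ : ℝ → X := fun t => (u ^ ⌊t / τ⌋) (p (t - ⌊t / τ⌋ * τ)) with hℓ
  have hfl : ∀ t : ℝ, 0 ≤ t - ⌊t / τ⌋ * τ ∧ t - ⌊t / τ⌋ * τ ≤ τ := by
    intro t
    have a1 := (le_div_iff₀ hτ).1 (Int.floor_le (t / τ))
    have a2 := (div_lt_iff₀ hτ).1 (Int.lt_floor_add_one (t / τ))
    constructor <;> linarith
  have hl : ∀ t, dist ((u ^ ⌊t / τ⌋) m) (ℓ t) = t - ⌊t / τ⌋ * τ := fun t => by
    rw [hℓ, IsometryEquiv.dist_eq, (hp _ (hfl t).1 (hfl t).2).1]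
  have hr : ∀ t, dist (ℓ t) ((u ^ (⌊t / τ⌋ + 1)) m) = τ - (t - ⌊t / τ⌋ * τ) := fun t => by
    rw [zpow_add_one, IsometryEquiv.mul_apply, hℓ, IsometryEquiv.dist_eq,
      (hp _ (hfl t).1 (hfl t).2).2]
  have key : ∀ s t, s ≤ t → dist (ℓ s) (ℓ t) = t - s := by
    intro s t hst
    have hjk : ⌊s / τ⌋ ≤ ⌊t / τ⌋ := Int.floor_le_floor (div_le_div_of_nonneg_right hst hτ.le)
    rcases hjk.eq_or_lt with heq | hlt
    · have e := hpd (s - ⌊s / τ⌋ * τ) (hfl s).1 (t - ⌊t / τ⌋ * τ) (by rw [heq]; linarith) (hfl t).2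
      rw [hℓ]
      dsimp only
      rw [heq] at e ⊢
      rw [IsometryEquiv.dist_eq, e]
      ring
    · have a1 := hb (⌊s / τ⌋ + 1) ⌊t / τ⌋ hlt
      have a2 := hb ⌊s / τ⌋ (⌊t / τ⌋ + 1) (by linarith)
      have a3 := dist_triangle4 (ℓ s) ((u ^ (⌊s / τ⌋ + 1)) m) ((u ^ ⌊t / τ⌋) m) (ℓ t)
      have a4 := dist_triangle4 ((u ^ ⌊s / τ⌋) m) (ℓ s) (ℓ t) ((u ^ (⌊t / τ⌋ + 1)) m)
      push_cast at a1 a2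
      rw [hr, a1, hl] at a3
      rw [hl, hr, a2] at a4
      linarith
  refine ⟨ℓ, hτ, fun s t => ?_, fun t => ?_⟩
  · rcases le_total s t with h | h
    · rw [key s t h, abs_of_nonpos (by linarith)]; ring
    · rw [dist_comm, key t s h, abs_of_nonneg (by linarith)]
  · rw [hℓ]
    dsimp only
    rw [add_div, div_self hτ.ne', Int.floor_add_one, add_comm ⌊t / τ⌋ 1, zpow_one_add,
      IsometryEquiv.mul_apply]
    congr 3
    push_cast
    ring

/-- An isometry without fixed points has an axis. -/
theorem exists_isAxis (hX : IsGeodesicZeroHyperbolic X) (x : X) {u : X ≃ᵢ X}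
    (hu : ∀ y, u y ≠ y) : ∃ ℓ τ, IsAxis u ℓ τ := by
  set D := dist x (u x) with hD
  set E := dist x (u (u x)) with hE
  have hD0 : 0 ≤ D := dist_nonneg
  obtain ⟨m, hm1, hm2⟩ := hX.exists_between x (u x) (D / 2) (by linarith) (by linarith)
  have e1 : dist (u x) (u (u x)) = D := u.dist_eq _ _
  have e2 : dist (u x) (u m) = D / 2 := by rw [u.dist_eq, hm1]
  have e3 : dist (u m) (u (u x)) = D / 2 := by rw [u.dist_eq, hm2]; linarith
  have e4 : dist (u (u x)) (u (u m)) = D / 2 := by rw [u.dist_eq, e2]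
  have e5 : dist m (u m) = dist (u m) (u (u m)) := (u.dist_eq _ _).symm
  have hmpos := dist_pos.2 (hu m).symm
  have f1 : dist (u m) x ≤ max E D - D / 2 := by
    rcases hX.four_point_or (u m) x (u x) (u (u x)) with h | h
    · linarith [le_max_left E D, dist_comm (u m) (u x)]
    · linarith [le_max_right E D, dist_comm (u m) (u x)]
  have f2 : dist m (u m) + D ≤ D / 2 + dist (u m) x ∨ dist m (u m) + D ≤ D := by
    rcases hX.four_point_or m (u m) (u x) x with h | h
    · left
      linarith [dist_comm x (u x)]
    · right
      linarith [dist_comm x (u x), dist_comm x m, dist_comm (u x) (u m)]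
  have hED : D < E := by
    by_contra! hcon
    rw [max_eq_right hcon] at f1
    rcases f2 with f2 | f2 <;> linarith
  rw [max_eq_left hED.le] at f1
  have f3 := dist_triangle4 x m (u m) (u (u x))
  have f4 : dist m (u m) = E - D := by
    rcases f2 with f2 | f2 <;> linarith
  have f5 := dist_triangle x m (u (u x))
  have f6 := dist_triangle m (u m) (u (u m))
  have f7 : dist (u m) (u (u m)) = E - D := e5.symm.trans f4
  obtain ⟨ℓ, hℓ⟩ := hX.exists_isAxis_of_dist (sub_pos.2 hED) f4 (by
    rcases hX.four_point_or m (u (u x)) (u m) (u (u m)) with h | h <;>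
      linarith [dist_comm (u m) (u (u x))])
  exact ⟨ℓ, _, hℓ⟩

theorem dist_apply_apply_le (hX : IsGeodesicZeroHyperbolic X) {w : X ≃ᵢ X} {p : X}
    (hp : w p = p) (x : X) : dist x (w (w x)) ≤ dist x (w x) := by
  have e1 : dist (w x) p = dist x p := by conv_lhs => rw [← hp, w.dist_eq]
  have e2 : dist (w (w x)) p = dist x p := by conv_lhs => rw [← hp, w.dist_eq, e1]
  have e3 : dist (w x) (w (w x)) = dist x (w x) := w.dist_eq _ _
  rcases hX.four_point_or x (w (w x)) (w x) p with h | h <;>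
    linarith [dist_comm (w x) (w (w x))]

theorem exists_forall_mul_pow_ne (hX : IsGeodesicZeroHyperbolic X) {h g : X ≃ᵢ X}
    {ℓ : ℝ → X} {τ : ℝ} (hℓ : IsAxis h ℓ τ)
    (hg : ¬ Asymptotic (g ∘ ℓ) (fun t => ℓ (-t))) :
    ∃ n₀ : ℕ, ∀ n, n₀ ≤ n → ∀ p, (g * h ^ n) p ≠ p := by
  obtain ⟨C, T, hT, hC⟩ := hX.exists_dist_ray_eq (hℓ.isometricRay.map g) hℓ.inv.isometricRay hg
  set K := dist (ℓ 0) (g (ℓ 0)) with hK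
  have hτ := hℓ.pos
  obtain ⟨n₀, hn₀⟩ := exists_nat_gt ((max T (C + 2 * K)) / τ)
  rw [div_lt_iff₀ hτ] at hn₀
  refine ⟨n₀, fun n hn p hp => ?_⟩
  have hn' : (n₀ : ℝ) * τ ≤ n * τ := by gcongr
  have hnT := le_max_left T (C + 2 * K)
  have hnC := le_max_right T (C + 2 * K)
  have e1 := hX.dist_apply_apply_le hp (ℓ 0)
  simp only [IsometryEquiv.mul_apply] at e1
  rw [hℓ.pow_map_eq, zero_add] at e1
  have e2 : dist (ℓ 0) (g (ℓ (n * τ))) ≤ K + n * τ := by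
    have := dist_triangle (ℓ 0) (g (ℓ 0)) (g (ℓ (n * τ)))
    rw [g.dist_eq, hℓ.isometricRay.dist_of_le le_rfl (by linarith)] at this
    linarith
  have e3 : dist (g (ℓ 0)) (g ((h ^ n) (g (ℓ (n * τ))))) = 2 * (n * τ) - C := by
    have : ℓ 0 = (h ^ n) (ℓ (-(n * τ))) := by rw [hℓ.pow_map_eq, neg_add_cancel]
    rw [g.dist_eq, this, (h ^ n).dist_eq, dist_comm]
    refine (hC _ (by linarith) _ (by linarith)).trans (by ring)
  have e4 := dist_triangle (g (ℓ 0)) (ℓ 0) (g ((h ^ n) (g (ℓ (n * τ)))))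
  rw [dist_comm (g (ℓ 0)) (ℓ 0)] at e4
  linarith

end IsGeodesicZeroHyperbolic

end Ends

theorem MulAction.exists_forall_smul_ne (H Ω : Type*) [Group H] [MulAction H Ω] [Finite Ω]
    [Nontrivial Ω] [MulAction.IsPretransitive H Ω] : ∃ h : H, ∀ ω : Ω, h • ω ≠ ω := by
  classical
  have := Fintype.ofFinite Ω
  set K := (MulAction.toPermHom H Ω).range with hK
  have : Fintype K := Fintype.ofFinite K
  have hpre : MulAction.IsPretransitive K Ω := ⟨fun x y => by
    obtain ⟨h, hh⟩ := MulAction.exists_smul_eq H x y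
    exact ⟨⟨MulAction.toPermHom H Ω h, h, rfl⟩, hh⟩⟩
  have hburn := MulAction.sum_card_fixedBy_eq_card_orbits_mul_card_group K Ω
  have horb : Fintype.card (Quotient (MulAction.orbitRel K Ω)) = 1 := by
    have := MulAction.pretransitive_iff_subsingleton_quotient K Ω |>.1 hpre
    exact Fintype.card_eq_one_iff_nonempty_unique.2
      ⟨⟨⟨Quotient.mk'' (Classical.arbitrary Ω)⟩, fun a => this.elim _ _⟩⟩
  rw [horb, one_mul] at hburn
  by_contra! hcon
  have hlt : ∑ _k : K, 1 < ∑ k : K, Fintype.card (MulAction.fixedBy Ω k) := by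
    refine Finset.sum_lt_sum (fun k _ => ?_) ⟨1, Finset.mem_univ _, ?_⟩
    · obtain ⟨_, h, rfl⟩ := k
      obtain ⟨ω, hω⟩ := hcon h
      exact Fintype.card_pos_iff.2 ⟨⟨ω, hω⟩⟩
    · rw [Fintype.one_lt_card_iff_nontrivial, MulAction.fixedBy_one_eq_univ]
      exact Set.nontrivial_coe_sort.2 Set.nontrivial_univ
  rw [hburn] at hlt
  simp at hlt

section Directions

variable {X : Type*} [MetricSpace X]

/-- Two parametrized rays from `x` have the same direction when they meet outside `x`. -/
def directionSetoid (hX : IsGeodesicZeroHyperbolic X) (x : X) :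
    Setoid {γ : ℝ → X // IsometricRay γ ∧ γ 0 = x} where
  r γ δ := ∃ r, 0 < r ∧ γ.1 r = δ.1 r
  iseqv :=
    { refl := fun γ => ⟨1, one_pos, rfl⟩
      symm := fun ⟨r, hr, h⟩ => ⟨r, hr, h.symm⟩
      trans := by
        rintro ⟨γ, hγ, hγ0⟩ ⟨δ, hδ, hδ0⟩ ⟨ε, hε, hε0⟩ ⟨r, hr, h⟩ ⟨s, hs, h'⟩
        refine ⟨min r s, lt_min hr hs, ?_⟩
        exact (hX.ray_eq_of_le hγ hδ (hγ0.trans hδ0.symm) (lt_min hr hs).le (min_le_left _ _)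
          h).trans (hX.ray_eq_of_le hδ hε (hδ0.trans hε0.symm) (lt_min hr hs).le
            (min_le_right _ _) h') }

/-- The directions at `x`. -/
def Direction (hX : IsGeodesicZeroHyperbolic X) (x : X) : Type _ :=
  Quotient (directionSetoid hX x)

/-- The direction at `x` of a parametrized ray from `x`. -/
def Direction.mk (hX : IsGeodesicZeroHyperbolic X) {x : X} (γ : ℝ → X) (hγ : IsometricRay γ)
    (h0 : γ 0 = x) : Direction hX x :=
  Quotient.mk (directionSetoid hX x) ⟨γ, hγ, h0⟩

theorem Direction.mk_eq_mk_iff (hX : IsGeodesicZeroHyperbolic X) {x : X} {γ δ : ℝ → X}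
    {hγ : IsometricRay γ} {hγ0 : γ 0 = x} {hδ : IsometricRay δ} {hδ0 : δ 0 = x} :
    Direction.mk hX γ hγ hγ0 = Direction.mk hX δ hδ hδ0 ↔ ∃ r, 0 < r ∧ γ r = δ r :=
  Quotient.eq (r := directionSetoid hX x)

theorem Direction.mk_ne_mk_iff (hX : IsGeodesicZeroHyperbolic X) {x : X} {γ δ : ℝ → X}
    {hγ : IsometricRay γ} {hγ0 : γ 0 = x} {hδ : IsometricRay δ} {hδ0 : δ 0 = x} :
    Direction.mk hX γ hγ hγ0 ≠ Direction.mk hX δ hδ hδ0 ↔ ∀ r, 0 < r → γ r ≠ δ r := by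
  rw [Ne, Direction.mk_eq_mk_iff]
  push Not
  rfl

theorem Direction.exists_mk (hX : IsGeodesicZeroHyperbolic X) {x : X} (A : Direction hX x) :
    ∃ γ hγ hγ0, Direction.mk hX γ hγ hγ0 = A := by
  induction A using Quotient.inductionOn with
  | h γ => exact ⟨γ.1, γ.2.1, γ.2.2, rfl⟩

theorem LocallyFiniteTree.finite_direction (hlf : LocallyFiniteTree X)
    (hX : IsGeodesicZeroHyperbolic X) (x : X) : Finite (Direction hX x) := by
  obtain ⟨n, Rs, hRs, hcov⟩ := hlf x
  choose γ hγ hγ0 hγR using hRs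
  refine Finite.of_surjective (fun i => Direction.mk hX (γ i) (hγ i) (hγ0 i)) fun A => ?_
  obtain ⟨δ, hδ, hδ0, rfl⟩ := Direction.exists_mk hX A
  obtain ⟨i, p, ⟨⟨s, hs, hsp⟩, hp⟩, hpx⟩ := hcov _ ⟨δ, hδ, hδ0, rfl⟩
  rw [hγR] at hp
  obtain ⟨t, ht, htp⟩ := hp
  have e1 := hδ.dist_of_le le_rfl hs
  have e2 := IsometricRay.dist_of_le (hγ i) le_rfl ht
  rw [hδ0, hsp] at e1
  rw [hγ0, htp] at e2
  obtain rfl : t = s := by linarith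
  refine ⟨i, (Direction.mk_eq_mk_iff hX).2 ⟨t, ?_, by rw [hsp, htp]⟩⟩
  have := dist_pos.2 hpx.symm
  linarith

/-- The isometries fixing the point `x`. -/
def pointStabilizer (x : X) : Subgroup (X ≃ᵢ X) where
  carrier := {g | g x = x}
  one_mem' := rfl
  mul_mem' := fun {g h} hg hh => by
    change g (h x) = x
    rw [hh, hg]
  inv_mem' := fun {g} hg => by
    change g.symm x = x
    rw [IsometryEquiv.symm_apply_eq, hg]

instance (hX : IsGeodesicZeroHyperbolic X) (x : X) :
    MulAction (pointStabilizer x) (Direction hX x) where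
  smul g := Quotient.map (fun γ => ⟨g.1 ∘ γ.1, γ.2.1.map g.1,
      (congrArg g.1 γ.2.2).trans g.2⟩) fun _ _ ⟨r, hr, h⟩ => ⟨r, hr, congrArg g.1 h⟩
  one_smul A := by
    induction A using Quotient.inductionOn with
    | h γ => rfl
  mul_smul g h A := by
    induction A using Quotient.inductionOn with
    | h γ => rfl

theorem Direction.smul_mk_eq_of_asymptotic (hX : IsGeodesicZeroHyperbolic X) {x : X}
    {γ δ : ℝ → X} {hγ : IsometricRay γ} {hγ0 : γ 0 = x} {hδ : IsometricRay δ} {hδ0 : δ 0 = x}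
    (g : pointStabilizer x) (h : Asymptotic (g.1 ∘ γ) δ) :
    g • Direction.mk hX γ hγ hγ0 = Direction.mk hX δ hδ hδ0 := by
  have h0 : (g.1 ∘ γ) 0 = x := (congrArg g.1 hγ0).trans g.2
  exact (Direction.mk_eq_mk_iff hX (hγ := hγ.map g.1) (hγ0 := h0)).2
    ⟨1, one_pos, hX.eq_of_asymptotic (hγ.map g.1) hδ (h0.trans hδ0.symm) h zero_le_one⟩

theorem IsGeodesicZeroHyperbolic.pushEnd_ne_of_forall_smul_ne (hX : IsGeodesicZeroHyperbolic X)
    {x : X} (g : pointStabilizer x) (hg : ∀ A : Direction hX x, g • A ≠ A) {e : Set (Set X)}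
    (he : IsEnd e) : pushEnd g.1 e ≠ e := by
  obtain ⟨ε, hε, rfl⟩ := isEnd_iff.1 he
  obtain ⟨δ, hδ, hδ0, hδε⟩ := hX.exists_ray_from hε x
  rw [← (hX.endOf_eq_iff hδ hε).2 hδε, Ne, hX.pushEnd_endOf_eq_iff hδ hδ]
  exact fun h => hg _ (Direction.smul_mk_eq_of_asymptotic hX (hγ := hδ) (hγ0 := hδ0) g h)

end Directions

section TwoTransitive

variable {X : Type*} [MetricSpace X]

namespace IsGeodesicZeroHyperbolic

theorem eventually_fixes_ray (hX : IsGeodesicZeroHyperbolic X) {g : X ≃ᵢ X} {p : X}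
    (hp : g p = p) {α : ℝ → X} (hα : IsometricRay α) (hg : Asymptotic (g ∘ α) α) :
    ∀ᶠ t in atTop, g (α t) = α t := by
  obtain ⟨δ, hδ, hδ0, hδα⟩ := hX.exists_ray_from hα p
  obtain ⟨k, hk⟩ := hδα.symm
  have h := ((hδα.map g).trans hg).trans hδα.symm
  filter_upwards [hk, eventually_ge_atTop (-k)] with t ht htk
  rw [ht]
  exact hX.eq_of_asymptotic (hδ.map g) hδ (by simp [hδ0, hp]) h (by linarith)

theorem eventually_shift_inv {g : X ≃ᵢ X} {α : ℝ → X} {k : ℝ}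
    (h : ∀ᶠ t in atTop, g (α t) = α (t + k)) : ∀ᶠ t in atTop, g⁻¹ (α t) = α (t + -k) := by
  filter_upwards [(tendsto_atTop_add_const_right atTop (-k) tendsto_id).eventually h] with t ht
  change g.symm (α t) = _
  rw [IsometryEquiv.symm_apply_eq]
  simpa using ht.symm

theorem eventually_shift_mul {g h : X ≃ᵢ X} {α : ℝ → X} {k l : ℝ}
    (hg : ∀ᶠ t in atTop, g (α t) = α (t + k)) (hh : ∀ᶠ t in atTop, h (α t) = α (t + l)) :
    ∀ᶠ t in atTop, (g * h) (α t) = α (t + (k + l)) := by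
  filter_upwards [hh, (tendsto_atTop_add_const_right atTop l tendsto_id).eventually hg]
    with t ht ht'
  rw [IsometryEquiv.mul_apply, ht]
  refine Eq.trans ht' ?_
  rw [id, add_assoc, add_comm l k]

theorem asymptotic_inv {g : X ≃ᵢ X} {α β : ℝ → X} (h : Asymptotic (g ∘ α) β) :
    Asymptotic (⇑(g⁻¹ : X ≃ᵢ X) ∘ β) α := by
  have := (h.map ⇑(g⁻¹ : X ≃ᵢ X)).symm
  rwa [← Function.comp_assoc, show ⇑(g⁻¹ : X ≃ᵢ X) ∘ g = id from
    funext fun x => g.symm_apply_apply x, Function.id_comp] at this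

theorem asymptotic_mul {g h : X ≃ᵢ X} {α β γ : ℝ → X} (hh : Asymptotic (h ∘ α) β)
    (hg : Asymptotic (g ∘ β) γ) : Asymptotic ((g * h : X ≃ᵢ X) ∘ α) γ :=
  (hh.map g).trans hg

theorem apply_eq_of_eventually_fixes_ray (hX : IsGeodesicZeroHyperbolic X) {x : X}
    {α β δ : ℝ → X} (hα : IsometricRay α) (hβ : IsometricRay β) (hδ : IsometricRay δ)
    (hα0 : α 0 = x) (hβ0 : β 0 = x) (hδ0 : δ 0 = x) (hαβ : ∀ r, 0 < r → α r ≠ β r)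
    (hαδ : ∀ r, 0 < r → α r ≠ δ r) {v : X ≃ᵢ X} (hvα : ∀ᶠ t in atTop, v (α t) = α t)
    (hvβ : Asymptotic (v ∘ β) δ) : v x = x := by
  obtain ⟨T, hvT, hT⟩ := (hvα.and (eventually_ge_atTop 0)).exists
  obtain ⟨β', hβ', hβ'0, hβ'a, hβ's⟩ := hX.exists_ray_from_of_dist_eq (m := α T) (k := -T) (T := 0)
    hβ le_rfl (fun s hs => by
      rw [hX.dist_ray_of_forall_ne hα hβ (hα0.trans hβ0.symm) hαβ hT hs]; ring)
  obtain ⟨δ', hδ', hδ'0, hδ'a, hδ's⟩ := hX.exists_ray_from_of_dist_eq (m := α T) (k := -T) (T := 0)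
    hδ le_rfl (fun s hs => by
      rw [hX.dist_ray_of_forall_ne hα hδ (hα0.trans hδ0.symm) hαδ hT hs]; ring)
  have h := hX.eq_of_asymptotic (hβ'.map v) hδ' (by simp [hβ'0, hδ'0, hvT])
    (((hβ'a.map v).trans hvβ).trans hδ'a.symm) hT
  rwa [Function.comp_apply, hβ's T (by linarith), hδ's T (by linarith), add_neg_cancel, hβ0,
    hδ0] at h

/-- In a group acting two-transitively on the ends, the isometries fixing a point and an end are
transitive on the remaining directions at that point. -/
theorem exists_fixing_point_of_two_transitive (hX : IsGeodesicZeroHyperbolic X)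
    {G : Subgroup (X ≃ᵢ X)}
    (hG : ∀ α β α' β' : ℝ → X, IsometricRay α → IsometricRay β → IsometricRay α' →
      IsometricRay β' → ¬ Asymptotic α β → ¬ Asymptotic α' β' →
      ∃ g ∈ G, Asymptotic (g ∘ α) α' ∧ Asymptotic (g ∘ β) β')
    {x : X} {α β δ : ℝ → X} (hα : IsometricRay α) (hβ : IsometricRay β) (hδ : IsometricRay δ)
    (hα0 : α 0 = x) (hβ0 : β 0 = x) (hδ0 : δ 0 = x) (hαβ : ∀ r, 0 < r → α r ≠ β r)
    (hαδ : ∀ r, 0 < r → α r ≠ δ r) :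
    ∃ g ∈ G, g x = x ∧ Asymptotic (g ∘ α) α ∧ Asymptotic (g ∘ β) δ := by
  have hnβ : ¬ Asymptotic α β := fun h =>
    hαβ 1 one_pos (hX.eq_of_asymptotic hα hβ (hα0.trans hβ0.symm) h zero_le_one)
  have hnδ : ¬ Asymptotic α δ := fun h =>
    hαδ 1 one_pos (hX.eq_of_asymptotic hα hδ (hα0.trans hδ0.symm) h zero_le_one)
  suffices h : ∃ v ∈ G, (∀ᶠ t in atTop, v (α t) = α t) ∧ Asymptotic (v ∘ β) δ by
    obtain ⟨v, hv, hvα, hvβ⟩ := h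
    exact ⟨v, hv, hX.apply_eq_of_eventually_fixes_ray hα hβ hδ hα0 hβ0 hδ0 hαβ hαδ hvα hvβ,
      ⟨0, by simpa using hvα⟩, hvβ⟩
  obtain ⟨g, hg, hgα, hgβ⟩ := hG α β α δ hα hβ hα hδ hnβ hnδ
  by_cases hfix : ∃ p, g p = p
  · obtain ⟨p, hp⟩ := hfix
    exact ⟨g, hg, hX.eventually_fixes_ray hp hα hgα, hgβ⟩
  push Not at hfix
  obtain ⟨ℓ, τ, hℓ⟩ := hX.exists_isAxis x hfix
  obtain ⟨ε, hε, hgε, hnε⟩ : ∃ ε, IsometricRay ε ∧ Asymptotic (g ∘ ε) ε ∧ ¬ Asymptotic α ε := by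
    rcases hℓ.asymptotic_or hX hα hgα with h | h
    · exact ⟨_, hℓ.inv.isometricRay, hℓ.asymptotic_map_neg,
        fun h' => hℓ.not_asymptotic (h.symm.trans h')⟩
    · exact ⟨_, hℓ.isometricRay, hℓ.asymptotic_map,
        fun h' => hℓ.not_asymptotic (h'.symm.trans h)⟩
  obtain ⟨k, hk, hkα, hkε⟩ := hG α ε α β hα hε hα hβ hnε hnβ
  obtain ⟨c, hc⟩ := hgα
  obtain ⟨d, hd⟩ := hkα
  refine ⟨g * (k * g * k⁻¹)⁻¹, G.mul_mem hg (G.inv_mem (G.mul_mem (G.mul_mem hk hg)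
    (G.inv_mem hk))), ?_, ?_⟩
  · have := eventually_shift_mul hc (eventually_shift_inv
      (eventually_shift_mul (eventually_shift_mul hd hc) (eventually_shift_inv hd)))
    rw [show c + -(d + c + -d) = 0 by ring] at this
    simpa only [add_zero] using this
  · exact asymptotic_mul (asymptotic_inv (asymptotic_mul (asymptotic_inv hkε)
      (asymptotic_mul hgε hkε))) hgβ

/-- At a point of valency at least three, the stabilizer in a group acting two-transitively on
the ends contains a derangement of the directions which does not send a given direction to
another given one. -/
theorem exists_derangement_of_two_transitive (hX : IsGeodesicZeroHyperbolic X)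
    {G : Subgroup (X ≃ᵢ X)}
    (hG : ∀ α β α' β' : ℝ → X, IsometricRay α → IsometricRay β → IsometricRay α' →
      IsometricRay β' → ¬ Asymptotic α β → ¬ Asymptotic α' β' →
      ∃ g ∈ G, Asymptotic (g ∘ α) α' ∧ Asymptotic (g ∘ β) β')
    {x : X} [Finite (Direction hX x)] {A B C : Direction hX x} (hAB : A ≠ B) (hAC : A ≠ C)
    (hBC : B ≠ C) :
    ∃ g : pointStabilizer x, g.1 ∈ G ∧ (∀ P : Direction hX x, g • P ≠ P) ∧ g • A ≠ B := by
  have key : ∀ P Q R : Direction hX x, P ≠ Q → P ≠ R →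
      ∃ g : pointStabilizer x, g.1 ∈ G ∧ g • P = P ∧ g • Q = R := by
    intro P Q R hPQ hPR
    obtain ⟨α, hα, hα0, rfl⟩ := Direction.exists_mk hX P
    obtain ⟨β, hβ, hβ0, rfl⟩ := Direction.exists_mk hX Q
    obtain ⟨δ, hδ, hδ0, rfl⟩ := Direction.exists_mk hX R
    rw [Direction.mk_ne_mk_iff] at hPQ hPR
    obtain ⟨g, hg, hgx, h1, h2⟩ :=
      hX.exists_fixing_point_of_two_transitive hG hα hβ hδ hα0 hβ0 hδ0 hPQ hPR
    exact ⟨⟨g, hgx⟩, hg, Direction.smul_mk_eq_of_asymptotic hX ⟨g, hgx⟩ h1,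
      Direction.smul_mk_eq_of_asymptotic hX ⟨g, hgx⟩ h2⟩
  have : Nontrivial (Direction hX x) := ⟨A, B, hAB⟩
  have : MulAction.IsPretransitive (G.subgroupOf (pointStabilizer x)) (Direction hX x) := by
    refine ⟨fun Q R => ?_⟩
    obtain ⟨P, hPQ, hPR⟩ : ∃ P, P ≠ Q ∧ P ≠ R := by
      by_contra! hcon
      rcases eq_or_ne A Q with rfl | hA
      · exact hBC ((hcon B hAB.symm).trans (hcon C hAC.symm).symm)
      rcases eq_or_ne B Q with rfl | hB
      · exact hAC ((hcon A hA).trans (hcon C hBC.symm).symm)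
      · exact hAB ((hcon A hA).trans (hcon B hB).symm)
    obtain ⟨g, hg, -, h⟩ := key P Q R hPQ hPR
    exact ⟨⟨g, hg⟩, h⟩
  obtain ⟨⟨g, hg⟩, hgd⟩ :=
    MulAction.exists_forall_smul_ne (G.subgroupOf (pointStabilizer x)) (Direction hX x)
  replace hgd : ∀ P : Direction hX x, g • P ≠ P := hgd
  by_cases hgA : g • A = B
  · obtain ⟨k, hk, hkA, hkB⟩ := key A B C hAB hAC
    refine ⟨k * g * k⁻¹, G.mul_mem (G.mul_mem hk hg) (G.inv_mem hk), fun P hP => ?_, ?_⟩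
    · rw [mul_smul, mul_smul, ← eq_inv_smul_iff] at hP
      exact hgd _ hP
    · rw [mul_smul, mul_smul, inv_smul_eq_iff.2 hkA.symm, hgA, hkB]
      exact hBC.symm
  · exact ⟨g, hg, hgd, hgA⟩

theorem exists_pushEnd_eq (hX : IsGeodesicZeroHyperbolic X) (x : X) {u : X ≃ᵢ X}
    (hu : ∀ y, u y ≠ y) : ∃ e, IsEnd e ∧ pushEnd u e = e := by
  obtain ⟨ℓ, τ, hℓ⟩ := hX.exists_isAxis x hu
  exact ⟨_, isEnd_iff.2 ⟨ℓ, hℓ.isometricRay, rfl⟩,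
    (hX.pushEnd_endOf_eq_iff hℓ.isometricRay hℓ.isometricRay u).2 hℓ.asymptotic_map⟩

theorem fixed_ends_eq (hX : IsGeodesicZeroHyperbolic X) {u : X ≃ᵢ X} {ℓ : ℝ → X} {τ : ℝ}
    (hℓ : IsAxis u ℓ τ) :
    {e | IsEnd e ∧ pushEnd u e = e} = {endOf ℓ, endOf fun t => ℓ (-t)} := by
  have h1 := hℓ.isometricRay
  have h2 := hℓ.inv.isometricRay
  ext e
  simp only [Set.mem_ofPred_eq, Set.mem_insert_iff, Set.mem_singleton_iff]
  constructor
  · rintro ⟨he, hue⟩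
    obtain ⟨ρ, hρ, rfl⟩ := isEnd_iff.1 he
    rw [hX.endOf_eq_iff hρ h1, hX.endOf_eq_iff hρ h2]
    exact hℓ.asymptotic_or hX hρ ((hX.pushEnd_endOf_eq_iff hρ hρ u).1 hue)
  · rintro (rfl | rfl)
    · exact ⟨isEnd_iff.2 ⟨_, h1, rfl⟩, (hX.pushEnd_endOf_eq_iff h1 h1 u).2 hℓ.asymptotic_map⟩
    · exact ⟨isEnd_iff.2 ⟨_, h2, rfl⟩,
        (hX.pushEnd_endOf_eq_iff h2 h2 u).2 hℓ.asymptotic_map_neg⟩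

theorem exists_mul_zpow_fixes_end (hX : IsGeodesicZeroHyperbolic X) {h g : X ≃ᵢ X} {ℓ : ℝ → X}
    {τ : ℝ} (hℓ : IsAxis h ℓ τ)
    (hg : ({pushEnd g (endOf ℓ), pushEnd g (endOf fun t => ℓ (-t))} : Set (Set (Set X))) ≠
      {endOf ℓ, endOf fun t => ℓ (-t)}) {N : ℕ} (hN : 0 < N) :
    ∃ n : ℤ, n ≠ 0 ∧ ∃ e, IsEnd e ∧ pushEnd (⇑(g * h ^ ((N : ℤ) * n))) e = e := by
  have h1 := hℓ.isometricRay
  have h2 := hℓ.inv.isometricRay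
  have hle : ∀ n₀ : ℕ, n₀ ≤ N * (n₀ + 1) := fun n₀ => by nlinarith
  by_cases hplus : Asymptotic (g ∘ ℓ) (fun t => ℓ (-t))
  · have hminus : ¬ Asymptotic (g ∘ fun t => ℓ (-t)) (fun t => ℓ (- -t)) := by
      intro hcon
      simp only [neg_neg] at hcon
      refine hg ?_
      rw [(hX.pushEnd_endOf_eq_iff h1 h2 g).2 hplus, (hX.pushEnd_endOf_eq_iff h2 h1 g).2 hcon,
        Set.pair_comm]
    obtain ⟨n₀, hn₀⟩ := hX.exists_forall_mul_pow_ne hℓ.inv hminus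
    refine ⟨-(n₀ + 1 : ℕ), by omega, hX.exists_pushEnd_eq (ℓ 0) ?_⟩
    have := hn₀ (N * (n₀ + 1)) (hle n₀)
    rwa [inv_pow, ← zpow_natCast, ← zpow_neg, Nat.cast_mul, ← mul_neg] at this
  · obtain ⟨n₀, hn₀⟩ := hX.exists_forall_mul_pow_ne hℓ hplus
    refine ⟨(n₀ + 1 : ℕ), by omega, hX.exists_pushEnd_eq (ℓ 0) ?_⟩
    have := hn₀ (N * (n₀ + 1)) (hle n₀)
    rwa [← zpow_natCast, Nat.cast_mul] at this

end IsGeodesicZeroHyperbolic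

end TwoTransitive

/-- The nontrivial implication for an elliptic isometry fixing exactly two ends. -/
theorem IsGeodesicZeroHyperbolic.exists_of_fixes_point {X : Type*} [MetricSpace X]
    (hX : IsGeodesicZeroHyperbolic X) (hlf : LocallyFiniteTree X)
    (hinf : {e : Set (Set X) | IsEnd e}.Infinite) {G : Subgroup (X ≃ᵢ X)}
    (h2trans : ∀ a b a' b' : Set (Set X), IsEnd a → IsEnd b → IsEnd a' → IsEnd b' →
      a ≠ b → a' ≠ b' → ∃ g ∈ G, pushEnd (⇑g) a = a' ∧ pushEnd (⇑g) b = b')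
    {h : X ≃ᵢ X} (hfix : ∃ x : X, h x = x)
    (hcard : {e : Set (Set X) | IsEnd e ∧ pushEnd (⇑h) e = e}.encard = 2) :
    ∃ a b : Set (Set X), a ≠ b ∧ IsEnd a ∧ IsEnd b ∧
      {e : Set (Set X) | IsEnd e ∧ pushEnd (⇑h) e = e} = {a, b} ∧
      ∃ g ∈ G, (∀ e : Set (Set X), IsEnd e → pushEnd (⇑g) e ≠ e) ∧
        ({pushEnd (⇑g) a, pushEnd (⇑g) b} : Set (Set (Set X))) ≠ {a, b} ∧
        ∃ N : ℕ, 0 < N ∧ ∀ n : ℤ, n ≠ 0 →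
          ∀ e : Set (Set X), IsEnd e → pushEnd (⇑(g * h ^ ((N : ℤ) * n))) e ≠ e := by
  have hG : ∀ α β α' β' : ℝ → X, IsometricRay α → IsometricRay β → IsometricRay α' →
      IsometricRay β' → ¬ Asymptotic α β → ¬ Asymptotic α' β' →
      ∃ g ∈ G, Asymptotic (g ∘ α) α' ∧ Asymptotic (g ∘ β) β' := by
    intro α β α' β' hα hβ hα' hβ' hne hne'
    rw [← hX.endOf_eq_iff hα hβ] at hne
    rw [← hX.endOf_eq_iff hα' hβ'] at hne'
    obtain ⟨g, hg, h1, h2⟩ := h2trans _ _ _ _ (isEnd_iff.2 ⟨_, hα, rfl⟩)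
      (isEnd_iff.2 ⟨_, hβ, rfl⟩) (isEnd_iff.2 ⟨_, hα', rfl⟩) (isEnd_iff.2 ⟨_, hβ', rfl⟩) hne hne'
    exact ⟨g, hg, (hX.pushEnd_endOf_eq_iff hα hα' g).1 h1,
      (hX.pushEnd_endOf_eq_iff hβ hβ' g).1 h2⟩
  obtain ⟨x, hx⟩ := hfix
  obtain ⟨a, b, hab, hfixed⟩ := Set.encard_eq_two.1 hcard
  obtain ⟨ha, hha⟩ : IsEnd a ∧ pushEnd h a = a := hfixed.ge (Set.mem_insert _ _)
  obtain ⟨hb, hhb⟩ : IsEnd b ∧ pushEnd h b = b :=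
    hfixed.ge (Set.mem_insert_of_mem _ (Set.mem_singleton _))
  obtain ⟨c, hc, hcab⟩ := hinf.exists_notMem_finite (Set.toFinite {a, b})
  refine ⟨a, b, hab, ha, hb, hfixed, ?_⟩
  obtain ⟨α, hα, rfl⟩ := isEnd_iff.1 ha
  obtain ⟨β, hβ, rfl⟩ := isEnd_iff.1 hb
  obtain ⟨γ, hγ, rfl⟩ := isEnd_iff.1 hc
  rw [Set.mem_insert_iff, Set.mem_singleton_iff, not_or] at hcab
  obtain ⟨m, α', β', γ', hα', hβ', hγ', hα0, hβ0, hγ0, hαa, hβa, hγa, hαβ, hαγ, hβγ⟩ :=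
    hX.exists_center hα hβ hγ (mt (hX.endOf_eq_iff hα hβ).2 hab)
      (fun h' => hcab.1 ((hX.endOf_eq_iff hα hγ).2 h').symm)
      (fun h' => hcab.2 ((hX.endOf_eq_iff hβ hγ).2 h').symm)
  rw [← (hX.endOf_eq_iff hα' hα).2 hαa] at hha ⊢
  rw [← (hX.endOf_eq_iff hβ' hβ).2 hβa] at hhb ⊢
  have hm : h m = m := by
    rw [← hα0]
    exact hX.apply_eq_of_fixes_line hα' hβ' (hα0.trans hβ0.symm) hαβ
      ((hX.pushEnd_endOf_eq_iff hα' hα' h).1 hha) ((hX.pushEnd_endOf_eq_iff hβ' hβ' h).1 hhb) hx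
  have := hlf.finite_direction hX m
  obtain ⟨g, hg, hgd, hgab⟩ := hX.exists_derangement_of_two_transitive hG
    (A := Direction.mk hX α' hα' hα0) (B := Direction.mk hX β' hβ' hβ0)
    (C := Direction.mk hX γ' hγ' hγ0) ((Direction.mk_ne_mk_iff hX).2 hαβ)
    ((Direction.mk_ne_mk_iff hX).2 hαγ) ((Direction.mk_ne_mk_iff hX).2 hβγ)
  refine ⟨g.1, hg, fun e he => hX.pushEnd_ne_of_forall_smul_ne g hgd he, fun hcon => ?_, ?_⟩
  · rcases hcon.le (Set.mem_insert _ _) with h1 | h1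
    · exact hX.pushEnd_ne_of_forall_smul_ne g hgd (isEnd_iff.2 ⟨α', hα', rfl⟩) h1
    · exact hgab (Direction.smul_mk_eq_of_asymptotic hX g
        ((hX.pushEnd_endOf_eq_iff hα' hβ' g.1).1 h1))
  · set k : pointStabilizer m := ⟨h, hm⟩ with hk
    set σ := MulAction.toPermHom (pointStabilizer m) (Direction hX m) with hσ
    refine ⟨orderOf (σ k), orderOf_pos _, fun n _ e he => ?_⟩
    refine hX.pushEnd_ne_of_forall_smul_ne (g * k ^ ((orderOf (σ k) : ℤ) * n)) (fun A => ?_) he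
    have htriv : σ (k ^ ((orderOf (σ k) : ℤ) * n)) = 1 := by
      rw [map_zpow, zpow_mul, zpow_natCast, pow_orderOf_eq_one, one_zpow]
    rw [mul_smul, show k ^ ((orderOf (σ k) : ℤ) * n) • A = A from DFunLike.congr_fun htriv A]
    exact hgd A

theorem elliptic_iff_fixed_end_condition {X : Type*} [MetricSpace X]
    (htree : IsRTree X) (hleaf : Leafless X) (hlf : LocallyFiniteTree X)
    (hends : AtLeastThreeEnds X) (hinf : {e : Set (Set X) | IsEnd e}.Infinite)
    (G : Subgroup (X ≃ᵢ X))
    (h2trans : ∀ a b a' b' : Set (Set X), IsEnd a → IsEnd b → IsEnd a' → IsEnd b' →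
      a ≠ b → a' ≠ b' → ∃ g ∈ G, pushEnd (⇑g) a = a' ∧ pushEnd (⇑g) b = b')
    (h : X ≃ᵢ X) (hh : h ∈ G) :
    (∃ x : X, h x = x) ↔
      ({e : Set (Set X) | IsEnd e ∧ pushEnd (⇑h) e = e}.encard ≠ 2 ∨
       (∃ a b : Set (Set X), a ≠ b ∧ IsEnd a ∧ IsEnd b ∧
          {e : Set (Set X) | IsEnd e ∧ pushEnd (⇑h) e = e} = {a, b} ∧
          ∃ g ∈ G, (∀ e : Set (Set X), IsEnd e → pushEnd (⇑g) e ≠ e) ∧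
            ({pushEnd (⇑g) a, pushEnd (⇑g) b} : Set (Set (Set X))) ≠ {a, b} ∧
            ∃ N : ℕ, 0 < N ∧ ∀ n : ℤ, n ≠ 0 →
              ∀ e : Set (Set X), IsEnd e → pushEnd (⇑(g * h ^ ((N : ℤ) * n))) e ≠ e)) := by
  have hX := htree.isGeodesicZeroHyperbolic
  constructor
  · intro hfix
    exact or_iff_not_imp_left.2 fun hcard =>
      hX.exists_of_fixes_point hlf hinf h2trans hfix (not_not.1 hcard)
  · intro hcond
    by_contra! hfix
    obtain ⟨e, -, -, he, -⟩ := hends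
    obtain ⟨ρ, -, -⟩ := isEnd_iff.1 he
    obtain ⟨ℓ, τ, hℓ⟩ := hX.exists_isAxis (ρ 0) hfix
    have hne : endOf ℓ ≠ endOf fun t => ℓ (-t) := fun hcon =>
      hℓ.not_asymptotic ((hX.endOf_eq_iff hℓ.isometricRay hℓ.inv.isometricRay).1 hcon)
    rw [hX.fixed_ends_eq hℓ] at hcond
    rcases hcond with hcard | ⟨a, b, -, -, -, hab, g, -, -, hg, N, hN, hgh⟩
    · exact hcard (Set.encard_pair hne)
    · rw [← Set.image_pair, ← hab, Set.image_pair] at hg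
      obtain ⟨n, hn, e, he, hge⟩ := hX.exists_mul_zpow_fixes_end hℓ hg hN
      exact hgh n hn e he hge
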